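/- Fix a temperature parameter β > 1. For every ε > 0 there exists J₀ > 0 such that for all J ≥ J₀ and all integers L ≥ 1, the finite-volume one-dimensional Ising measure with one-sided plus boundary conditions satisfies ⟨σ₀⟩_{L,J,β} ≥ 1 − ε, uniformly in L. Here ⟨σ₀⟩_{L,J,β} is the expectation of the spin at the origin under the probability measure on {−1,+1}^{[−L,L−1]∩ℤ} assigning to each configuration σ a probability proportional to exp( β ( Σ_{−L ≤ x < y ≤ L−1} J_{x,y} σ_x σ_y + Σ_{x=−L}^{L−1} h_x σ_x ) ), with couplings J_{x,y} = J if |x−y| = 1 and J_{x,y} = |x−y|^{−2} if |x−y| ≥ 2, and external field h_x = J·𝟙[x = L−1] + Σ_{y ≥ max(L, x+2)} (y−x)^{−2} (the effect of fixing all spins in [L, ∞) equal to +1). -/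

import Mathlib

/-- The ±1 spin value of a Boolean spin. -/
def spinVal (b : Bool) : ℝ := if b then 1 else -1

/-- Ising couplings: `J` for nearest neighbours, `|x-y|^{-2}` otherwise. -/
noncomputable def isingCoupling (J : ℝ) (x y : ℤ) : ℝ :=
  if (x - y).natAbs = 1 then J else 1 / ((x - y : ℤ) : ℝ) ^ 2

/-- External field at `x` summarizing plus boundary conditions on `[L, ∞)`:
`J·𝟙[x = L-1] + Σ_{y ≥ max(L, x+2)} (y - x)^{-2}`. -/
noncomputable def isingField (J : ℝ) (L : ℕ) (x : ℤ) : ℝ :=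
  (if x = (L : ℤ) - 1 then J else 0) +
    ∑' n : ℕ, 1 / (((max (L : ℤ) (x + 2) + (n : ℤ) - x : ℤ) : ℝ)) ^ 2

/-- The (β times the) Hamiltonian, with one-sided plus boundary conditions, of the spin
configuration `s` on `[-L, L-1] ∩ ℤ`. -/
noncomputable def isingHamiltonian (β J : ℝ) (L : ℕ)
    (s : {x : ℤ // x ∈ Finset.Icc (-(L : ℤ)) ((L : ℤ) - 1)} → Bool) : ℝ :=
  β * ((∑ x : {x : ℤ // x ∈ Finset.Icc (-(L : ℤ)) ((L : ℤ) - 1)},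
          ∑ y : {x : ℤ // x ∈ Finset.Icc (-(L : ℤ)) ((L : ℤ) - 1)},
            if (x : ℤ) < (y : ℤ) then
              isingCoupling J (x : ℤ) (y : ℤ) * spinVal (s x) * spinVal (s y) else 0) +
        ∑ x : {x : ℤ // x ∈ Finset.Icc (-(L : ℤ)) ((L : ℤ) - 1)},
          isingField J L (x : ℤ) * spinVal (s x))

namespace LongRangeIsing

open MeasureTheory ProbabilityTheory

section Griffiths

variable {G ι : Type*} [CommGroup G]

/-- A real character of order two, as a real-valued function. -/
def signChar (ψ : G →* ℤˣ) (g : G) : ℝ := ((ψ g : ℤ) : ℝ)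

lemma signChar_eq_or (ψ : G →* ℤˣ) (g : G) : signChar ψ g = 1 ∨ signChar ψ g = -1 := by
  rcases Int.units_eq_one_or (ψ g) with h | h <;> simp [signChar, h]

lemma signChar_mul (ψ φ : G →* ℤˣ) (g : G) :
    signChar (ψ * φ) g = signChar ψ g * signChar φ g := by
  simp [signChar]

lemma signChar_apply_mul (ψ : G →* ℤˣ) (g k : G) :
    signChar ψ (g * k) = signChar ψ g * signChar ψ k := by
  simp [signChar]

lemma signChar_eq_one (ψ : G →* ℤˣ) (g : G) : signChar ψ g = 1 ↔ ψ g = 1 := by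
  rcases Int.units_eq_one_or (ψ g) with h | h
  · simp [signChar, h]
  · simp only [signChar, h]; norm_num

/-- The ferromagnetic weight `∏ (1 + tᵢ χᵢ)`. -/
def ferroWeight (I : Finset ι) (χ : ι → G →* ℤˣ) (t : ι → ℝ) (g : G) : ℝ :=
  ∏ i ∈ I, (1 + t i * signChar (χ i) g)

lemma ferroWeight_nonneg (I : Finset ι) (χ : ι → G →* ℤˣ) (t : ι → ℝ)
    (ht : ∀ i ∈ I, 0 ≤ t i ∧ t i ≤ 1) (g : G) : 0 ≤ ferroWeight I χ t g := by
  refine Finset.prod_nonneg fun i hi => ?_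
  obtain ⟨h0, h1⟩ := ht i hi
  rcases signChar_eq_or (χ i) g with h | h <;> rw [h] <;> linarith

variable [Fintype G]

lemma sum_signChar_nonneg (ψ : G →* ℤˣ) : 0 ≤ ∑ g, signChar ψ g := by
  classical
  by_cases h : ψ = 1
  · exact Finset.sum_nonneg fun g _ => by simp [signChar, h]
  · obtain ⟨k, hk⟩ : ∃ k, ψ k ≠ 1 := by
      by_contra! hc
      exact h (MonoidHom.ext hc)
    have hk' : signChar ψ k = -1 :=
      (signChar_eq_or ψ k).resolve_left fun h' => hk ((signChar_eq_one ψ k).1 h')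
    have h1 : ∑ g, signChar ψ (g * k) = ∑ g, signChar ψ g :=
      Equiv.sum_comp (Equiv.mulRight k) (signChar ψ)
    simp only [signChar_apply_mul, hk', mul_neg, mul_one, Finset.sum_neg_distrib] at h1
    linarith

/-- First Griffiths inequality. -/
lemma griffiths_first (I : Finset ι) (χ : ι → G →* ℤˣ) (a b : ι → ℝ)
    (ha : ∀ i ∈ I, 0 ≤ a i) (hb : ∀ i ∈ I, 0 ≤ b i) (ψ : G →* ℤˣ) :
    0 ≤ ∑ g, signChar ψ g * ∏ i ∈ I, (a i + b i * signChar (χ i) g) := by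
  classical
  induction I using Finset.induction_on generalizing ψ with
  | empty => simpa using sum_signChar_nonneg ψ
  | insert i I hi ih =>
    have ha' : ∀ j ∈ I, 0 ≤ a j := fun j hj => ha j (Finset.mem_insert_of_mem hj)
    have hb' : ∀ j ∈ I, 0 ≤ b j := fun j hj => hb j (Finset.mem_insert_of_mem hj)
    have key : ∑ g, signChar ψ g * ∏ j ∈ insert i I, (a j + b j * signChar (χ j) g)
        = a i * ∑ g, signChar ψ g * ∏ j ∈ I, (a j + b j * signChar (χ j) g)
          + b i * ∑ g, signChar (ψ * χ i) g * ∏ j ∈ I, (a j + b j * signChar (χ j) g) := by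
      rw [Finset.mul_sum, Finset.mul_sum, ← Finset.sum_add_distrib]
      refine Finset.sum_congr rfl fun g _ => ?_
      rw [Finset.prod_insert hi, signChar_mul]
      ring
    rw [key]
    have := ha i (Finset.mem_insert_self i I)
    have := hb i (Finset.mem_insert_self i I)
    have := ih ha' hb' ψ
    have := ih ha' hb' (ψ * χ i)
    positivity

/-- Second Griffiths inequality. -/
lemma griffiths_second (I : Finset ι) (χ : ι → G →* ℤˣ) (t : ι → ℝ)
    (ht : ∀ i ∈ I, 0 ≤ t i ∧ t i ≤ 1) (ψ φ : G →* ℤˣ) :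
    (∑ g, signChar ψ g * ferroWeight I χ t g) * (∑ g, signChar φ g * ferroWeight I χ t g) ≤
      (∑ g, signChar ψ g * signChar φ g * ferroWeight I χ t g) * ∑ g, ferroWeight I χ t g := by
  have e1 : (∑ g, signChar ψ g * signChar φ g * ferroWeight I χ t g) * (∑ g, ferroWeight I χ t g)
      - (∑ g, signChar ψ g * ferroWeight I χ t g) * (∑ g, signChar φ g * ferroWeight I χ t g)
      = ∑ k, (1 - signChar φ k) * ∑ g, signChar (ψ * φ) g *
          ∏ i ∈ I, ((1 + t i ^ 2 * signChar (χ i) k)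
            + t i * (1 + signChar (χ i) k) * signChar (χ i) g) := by
    have e2 : ∀ g, (∑ k, ferroWeight I χ t k) = ∑ k, ferroWeight I χ t (g * k) := fun g =>
      (Equiv.sum_comp (Equiv.mulLeft g) (ferroWeight I χ t)).symm
    have e3 : ∀ g, (∑ k, signChar φ k * ferroWeight I χ t k)
        = ∑ k, signChar φ (g * k) * ferroWeight I χ t (g * k) := fun g =>
      (Equiv.sum_comp (Equiv.mulLeft g) (fun k => signChar φ k * ferroWeight I χ t k)).symm
    rw [Finset.sum_mul, Finset.sum_mul]
    simp_rw [Finset.mul_sum]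
    rw [← Finset.sum_sub_distrib, Finset.sum_comm (s := Finset.univ (α := G))]
    refine Finset.sum_congr rfl fun g _ => ?_
    rw [← Finset.mul_sum, ← Finset.mul_sum, e2 g, e3 g, Finset.mul_sum, Finset.mul_sum,
      ← Finset.sum_sub_distrib]
    refine Finset.sum_congr rfl fun k _ => ?_
    have e4 : ferroWeight I χ t g * ferroWeight I χ t (g * k)
        = ∏ i ∈ I, ((1 + t i ^ 2 * signChar (χ i) k)
            + t i * (1 + signChar (χ i) k) * signChar (χ i) g) := by
      rw [ferroWeight, ferroWeight, ← Finset.prod_mul_distrib]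
      refine Finset.prod_congr rfl fun i _ => ?_
      rw [signChar_apply_mul]
      rcases signChar_eq_or (χ i) g with h | h <;> rw [h] <;> ring
    rw [← e4, signChar_mul, signChar_apply_mul]
    ring
  have e5 : 0 ≤ ∑ k, (1 - signChar φ k) * ∑ g, signChar (ψ * φ) g *
          ∏ i ∈ I, ((1 + t i ^ 2 * signChar (χ i) k)
            + t i * (1 + signChar (χ i) k) * signChar (χ i) g) := by
    refine Finset.sum_nonneg fun k _ => mul_nonneg ?_ ?_
    · rcases signChar_eq_or φ k with h | h <;> rw [h] <;> norm_num
    · refine griffiths_first I χ _ _ (fun i hi => ?_) (fun i hi => ?_) _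
      · obtain ⟨h0, h1⟩ := ht i hi
        rcases signChar_eq_or (χ i) k with h | h <;> rw [h] <;> nlinarith
      · obtain ⟨h0, h1⟩ := ht i hi
        rcases signChar_eq_or (χ i) k with h | h <;> rw [h] <;> nlinarith
  linarith

lemma sum_ferroWeight_pos (I : Finset ι) (χ : ι → G →* ℤˣ) (t : ι → ℝ)
    (ht : ∀ i ∈ I, 0 ≤ t i ∧ t i ≤ 1) : 0 < ∑ g, ferroWeight I χ t g := by
  refine Finset.sum_pos' (fun g _ => ferroWeight_nonneg I χ t ht g) ⟨1, Finset.mem_univ _, ?_⟩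
  refine Finset.prod_pos fun i hi => ?_
  have := (ht i hi).1
  simp only [signChar, map_one, Units.val_one, Int.cast_one]
  linarith

/-- The expectation of `ψ` under the ferromagnetic weight. -/
noncomputable def ferroMean (I : Finset ι) (χ : ι → G →* ℤˣ) (t : ι → ℝ) (ψ : G →* ℤˣ) : ℝ :=
  (∑ g, signChar ψ g * ferroWeight I χ t g) / ∑ g, ferroWeight I χ t g

lemma ferroMean_nonneg (I : Finset ι) (χ : ι → G →* ℤˣ) (t : ι → ℝ)
    (ht : ∀ i ∈ I, 0 ≤ t i ∧ t i ≤ 1) (ψ : G →* ℤˣ) : 0 ≤ ferroMean I χ t ψ :=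
  div_nonneg (griffiths_first I χ (fun _ => 1) t (fun _ _ => zero_le_one)
    (fun i hi => (ht i hi).1) ψ) (sum_ferroWeight_pos I χ t ht).le

/-- Replacing one interaction by a perfect one with probability `p`, and by none otherwise,
decreases correlations as long as `p` is at most the strength of the interaction. -/
lemma ferroMean_dilute_one [DecidableEq ι] (I : Finset ι) (χ : ι → G →* ℤˣ) (t : ι → ℝ)
    (ht : ∀ i ∈ I, 0 ≤ t i ∧ t i ≤ 1) (ψ : G →* ℤˣ) {e : ι} (he : e ∈ I) {p : ℝ}
    (hp : p ≤ t e) :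
    (1 - p) * ferroMean I χ (Function.update t e 0) ψ
      + p * ferroMean I χ (Function.update t e 1) ψ ≤ ferroMean I χ t ψ := by
  set I' := I.erase e with hI'
  have ht' : ∀ i ∈ I', 0 ≤ t i ∧ t i ≤ 1 := fun i hi => ht i (Finset.mem_of_mem_erase hi)
  set A := ∑ g, signChar ψ g * ferroWeight I' χ t g with hA
  set B := ∑ g, signChar ψ g * signChar (χ e) g * ferroWeight I' χ t g with hB
  set C := ∑ g, ferroWeight I' χ t g with hC
  set D := ∑ g, signChar (χ e) g * ferroWeight I' χ t g with hD
  have hw : ∀ r : ℝ, ∀ g, ferroWeight I χ (Function.update t e r) g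
      = (1 + r * signChar (χ e) g) * ferroWeight I' χ t g := fun r g => by
    rw [ferroWeight, ← Finset.mul_prod_erase I _ he, Function.update_self, ferroWeight]
    congr 1
    refine Finset.prod_congr rfl fun i hi => ?_
    rw [Function.update_of_ne (Finset.ne_of_mem_erase hi)]
  have hF : ∀ r : ℝ, ferroMean I χ (Function.update t e r) ψ = (A + r * B) / (C + r * D) := by
    intro r
    simp only [ferroMean, hw, hA, hB, hC, hD, Finset.mul_sum, ← Finset.sum_add_distrib]
    congr 1
    · exact Finset.sum_congr rfl fun g _ => by ring
    · exact Finset.sum_congr rfl fun g _ => by ring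
  have hF' : ferroMean I χ t ψ = (A + t e * B) / (C + t e * D) := by
    rw [← hF, Function.update_eq_self]
  have hCpos : 0 < C := sum_ferroWeight_pos I' χ t ht'
  have hDnn : 0 ≤ D := griffiths_first I' χ (fun _ => 1) t (fun _ _ => zero_le_one)
    (fun i hi => (ht' i hi).1) (χ e)
  have hBC : A * D ≤ B * C := griffiths_second I' χ t ht' ψ (χ e)
  obtain ⟨h0, h1⟩ := ht e he
  have hpos1 : 0 < C + 1 * D := by linarith
  have hpos2 : 0 < C + t e * D := by positivity
  rw [hF, hF, hF', ← sub_nonneg]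
  have key : (A + t e * B) / (C + t e * D)
      - ((1 - p) * ((A + 0 * B) / (C + 0 * D)) + p * ((A + 1 * B) / (C + 1 * D)))
      = (B * C - A * D) * ((t e - p) * C + t e * (1 - p) * D) /
        (C * (C + t e * D) * (C + 1 * D)) := by
    have : C + 0 * D ≠ 0 := by simpa using hCpos.ne'
    field_simp
    ring
  rw [key]
  have h2 : 0 ≤ 1 - p := by linarith
  have h3 : 0 ≤ t e - p := by linarith
  have h4 : 0 ≤ B * C - A * D := by linarith
  positivity

/-- Diluting all the interactions in `s`. -/
lemma ferroMean_dilute [DecidableEq ι] (I : Finset ι) (χ : ι → G →* ℤˣ) (ψ : G →* ℤˣ)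
    (p : ι → ℝ) (hp0 : ∀ i ∈ I, 0 ≤ p i) (s : Finset ι) (hs : s ⊆ I) (t : ι → ℝ)
    (ht : ∀ i ∈ I, 0 ≤ t i ∧ t i ≤ 1) (hp : ∀ i ∈ s, p i ≤ t i) :
    ∑ η ∈ s.powerset, (∏ i ∈ s, if i ∈ η then p i else 1 - p i) *
      ferroMean I χ (fun i => if i ∈ s then (if i ∈ η then 1 else 0) else t i) ψ
      ≤ ferroMean I χ t ψ := by
  induction s using Finset.induction_on generalizing t with
  | empty => simp
  | insert e s he ih =>
    have heI : e ∈ I := hs (Finset.mem_insert_self e s)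
    have hsI : s ⊆ I := (Finset.subset_insert e s).trans hs
    have hpe := hp e (Finset.mem_insert_self e s)
    have hstep : ∀ r : ℝ, 0 ≤ r → r ≤ 1 →
        ∑ η ∈ s.powerset, (∏ i ∈ s, if i ∈ η then p i else 1 - p i) *
          ferroMean I χ (fun i => if i ∈ s then (if i ∈ η then 1 else 0)
            else Function.update t e r i) ψ
          ≤ ferroMean I χ (Function.update t e r) ψ := by
      intro r hr0 hr1
      refine ih hsI _ (fun i hi => ?_) (fun i hi => ?_)
      · by_cases h : i = e
        · subst h; simp [hr0, hr1]
        · rw [Function.update_of_ne h]; exact ht i hi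
      · have h : i ≠ e := fun h => he (h ▸ hi)
        rw [Function.update_of_ne h]; exact hp i (Finset.mem_insert_of_mem hi)
    have hpe0 := hp0 e heI
    have hpe1 : 0 ≤ 1 - p e := by linarith [(ht e heI).2]
    refine le_trans (le_of_eq ?_) ((add_le_add
      (mul_le_mul_of_nonneg_left (hstep 0 le_rfl zero_le_one) hpe1)
      (mul_le_mul_of_nonneg_left (hstep 1 zero_le_one le_rfl) hpe0)).trans
      (ferroMean_dilute_one I χ t ht ψ heI hpe))
    rw [Finset.sum_powerset_insert he, Finset.mul_sum, Finset.mul_sum]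
    congr 1
    · refine Finset.sum_congr rfl fun η hη => ?_
      have heη : e ∉ η := fun h => he (Finset.mem_powerset.1 hη h)
      rw [Finset.prod_insert he, if_neg heη, mul_assoc]
      congr 3
      funext i
      by_cases h : i = e
      · subst h; simp [he, heη]
      · simp [h]
    · refine Finset.sum_congr rfl fun η hη => ?_
      have heη : e ∉ η := fun h => he (Finset.mem_powerset.1 hη h)
      rw [Finset.prod_insert he, if_pos (Finset.mem_insert_self e η), mul_assoc]
      have hprod : ∏ i ∈ s, (if i ∈ insert e η then p i else 1 - p i)
          = ∏ i ∈ s, if i ∈ η then p i else 1 - p i := by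
        refine Finset.prod_congr rfl fun i hi => ?_
        have h : i ≠ e := fun h => he (h ▸ hi)
        simp [h]
      rw [hprod]
      congr 3
      funext i
      by_cases h : i = e
      · subst h; simp [he]
      · simp [h]

open Classical in
/-- A correlation is at least the probability that the open interactions force it. -/
lemma sum_forced_le_ferroMean (I : Finset ι) (χ : ι → G →* ℤˣ) (ψ : G →* ℤˣ)
    (p : ι → ℝ) (hp0 : ∀ i ∈ I, 0 ≤ p i) (s : Finset ι) (hs : s ⊆ I) (t : ι → ℝ)
    (ht : ∀ i ∈ I, 0 ≤ t i ∧ t i ≤ 1) (hp : ∀ i ∈ s, p i ≤ t i) :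
    ∑ η ∈ s.powerset with ∀ g, (∀ i ∈ η, χ i g = 1) → ψ g = 1,
      (∏ i ∈ s, if i ∈ η then p i else 1 - p i) ≤ ferroMean I χ t ψ := by
  refine le_trans ?_ (ferroMean_dilute I χ ψ p hp0 s hs t ht hp)
  rw [Finset.sum_filter]
  refine Finset.sum_le_sum fun η hη => ?_
  have hprod : 0 ≤ ∏ i ∈ s, if i ∈ η then p i else 1 - p i := by
    refine Finset.prod_nonneg fun i hi => ?_
    have := hp i hi
    have := (ht i (hs hi)).2
    split_ifs
    · exact hp0 i (hs hi)
    · linarith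
  have ht' : ∀ i ∈ I, 0 ≤ (if i ∈ s then (if i ∈ η then (1 : ℝ) else 0) else t i) ∧
      (if i ∈ s then (if i ∈ η then (1 : ℝ) else 0) else t i) ≤ 1 := by
    intro i hi
    have := ht i hi
    split_ifs <;> simp_all
  split_ifs with hforce
  · suffices h : ferroMean I χ
        (fun i => if i ∈ s then (if i ∈ η then (1 : ℝ) else 0) else t i) ψ = 1 by rw [h, mul_one]
    rw [ferroMean, div_eq_one_iff_eq (sum_ferroWeight_pos I χ _ ht').ne']
    refine Finset.sum_congr rfl fun g _ => ?_
    by_cases hg : ∀ i ∈ η, χ i g = 1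
    · rw [(signChar_eq_one ψ g).2 (hforce g hg), one_mul]
    · push Not at hg
      obtain ⟨i, hi, hne⟩ := hg
      have his : i ∈ s := Finset.mem_powerset.1 hη hi
      have h0 : ferroWeight I χ
          (fun i => if i ∈ s then (if i ∈ η then (1 : ℝ) else 0) else t i) g = 0 := by
        refine Finset.prod_eq_zero (hs his) ?_
        rw [(signChar_eq_or (χ i) g).resolve_left fun h => hne ((signChar_eq_one _ _).1 h)]
        simp [his, hi]
      rw [h0, mul_zero]
  · exact mul_nonneg hprod (ferroMean_nonneg I χ _ ht' ψ)

end Griffiths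

section Percolation

/-- The law of one edge: open (`true`) with probability `1 - exp (-c)`. -/
noncomputable def edgeLaw (c : NNReal) : Measure Bool :=
  ENNReal.ofReal (1 - Real.exp (-c)) • Measure.dirac true
    + ENNReal.ofReal (Real.exp (-c)) • Measure.dirac false

lemma exp_neg_coe_le_one (c : NNReal) : Real.exp (-(c : ℝ)) ≤ 1 := by
  simp

instance (c : NNReal) : IsProbabilityMeasure (edgeLaw c) := by
  constructor
  have h := exp_neg_coe_le_one c
  simp only [edgeLaw, Measure.add_apply, Measure.smul_apply, measure_univ, smul_eq_mul, mul_one]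
  rw [← ENNReal.ofReal_add (by linarith) (Real.exp_pos _).le]
  simp

lemma edgeLaw_singleton (c : NNReal) (b : Bool) :
    edgeLaw c {b} = ENNReal.ofReal (if b then 1 - Real.exp (-c) else Real.exp (-c)) := by
  cases b <;> simp [edgeLaw]

variable {E : Type*}

/-- Independent bond percolation, the edge `e` being closed with probability `exp (-c e)`. -/
noncomputable def percolation (c : E → NNReal) : Measure (E → Bool) :=
  Measure.infinitePi fun e => edgeLaw (c e)

instance (c : E → NNReal) : IsProbabilityMeasure (percolation c) := by
  unfold percolation; infer_instance

lemma percolation_cylinder (c : E → NNReal) (S : Finset E) (η : E → Bool) :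
    (percolation c).real {ω | ∀ e ∈ S, ω e = η e} =
      ∏ e ∈ S, if η e then 1 - Real.exp (-c e) else Real.exp (-c e) := by
  have h : {ω : E → Bool | ∀ e ∈ S, ω e = η e} = Set.pi S fun e => {η e} := by
    ext ω; simp
  have hnn : ∀ e, 0 ≤ if η e then 1 - Real.exp (-c e) else Real.exp (-c e) := fun e => by
    have := exp_neg_coe_le_one (c e)
    split_ifs
    · linarith
    · positivity
  rw [Measure.real, h, percolation, Measure.infinitePi_pi _ (fun _ _ => by measurability)]
  simp_rw [edgeLaw_singleton]
  rw [← ENNReal.ofReal_prod_of_nonneg fun e _ => hnn e,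
    ENNReal.toReal_ofReal (Finset.prod_nonneg fun e _ => hnn e)]

lemma percolation_closed (c : E → NNReal) (S : Finset E) :
    (percolation c).real {ω | ∀ e ∈ S, ω e = false} = Real.exp (-∑ e ∈ S, (c e : ℝ)) := by
  rw [percolation_cylinder c S fun _ => false]
  simp [← Real.exp_sum]

/-- The event `A` is determined by the edges in `S`. -/
def DeterminedBy (S : Finset E) (A : Set (E → Bool)) : Prop :=
  ∀ ⦃ω ω' : E → Bool⦄, (∀ e ∈ S, ω e = ω' e) → ω ∈ A → ω' ∈ A

lemma DeterminedBy.exists_preimage {S : Finset E} {A : Set (E → Bool)} (hA : DeterminedBy S A) :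
    ∃ A' : Set (S → Bool), A = S.restrict ⁻¹' A' := by
  refine ⟨S.restrict '' A, Set.Subset.antisymm (Set.subset_preimage_image _ _) ?_⟩
  rintro ω ⟨ω', hω', h⟩
  exact hA (fun e he => congrFun h ⟨e, he⟩) hω'

lemma DeterminedBy.measurableSet {S : Finset E} {A : Set (E → Bool)} (hA : DeterminedBy S A) :
    MeasurableSet A := by
  obtain ⟨A', rfl⟩ := hA.exists_preimage
  exact Finset.measurable_restrict S (Set.toFinite A').measurableSet

lemma DeterminedBy.mono {S T : Finset E} {A : Set (E → Bool)} (hA : DeterminedBy S A)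
    (h : S ⊆ T) : DeterminedBy T A :=
  fun _ _ hω => hA fun e he => hω e (h he)

lemma percolation_inter {c : E → NNReal} {S T : Finset E} (hST : Disjoint S T)
    {A B : Set (E → Bool)} (hA : DeterminedBy S A) (hB : DeterminedBy T B) :
    (percolation c).real (A ∩ B) = (percolation c).real A * (percolation c).real B := by
  obtain ⟨A', rfl⟩ := hA.exists_preimage
  obtain ⟨B', rfl⟩ := hB.exists_preimage
  have hind : iIndepFun (fun (e : E) (ω : E → Bool) => ω e) (percolation c) :=
    iIndepFun_infinitePi (X := fun _ => id) (fun _ => measurable_id)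
  have := hind.indepFun_finset S T hST (fun e => measurable_pi_apply e)
  have := this.measure_inter_preimage_eq_mul A' B' (Set.toFinite A').measurableSet
    (Set.toFinite B').measurableSet
  rw [Measure.real, Measure.real, Measure.real, ← ENNReal.toReal_mul]
  exact congrArg ENNReal.toReal this

/-- Conditioning on the edges in `S`: if for each configuration in `D` the event `D`, restricted
to the configurations agreeing with it on `S`, is contained in an event of probability at most
`q` determined by `T`, then `D` costs a factor `q`. -/
lemma percolation_le_mul {c : E → NNReal} {S T : Finset E} (hST : Disjoint S T)
    {B D : Set (E → Bool)} (hB : DeterminedBy S B) (hDB : D ⊆ B) {q : ℝ} (hq : 0 ≤ q)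
    (hD : ∀ η ∈ D, ∃ F, DeterminedBy T F ∧ (percolation c).real F ≤ q ∧
      ∀ ω ∈ D, (∀ e ∈ S, η e = ω e) → ω ∈ F) :
    (percolation c).real D ≤ q * (percolation c).real B := by
  classical
  have hD' : ∀ θ : S → Bool, ∃ F, DeterminedBy T F ∧ (percolation c).real F ≤ q ∧
      ∀ ω ∈ D, S.restrict ω = θ → ω ∈ F := by
    intro θ
    by_cases h : ∃ η ∈ D, S.restrict η = θ
    · obtain ⟨η, hη, rfl⟩ := h
      obtain ⟨F, hF, hFq, hFD⟩ := hD η hη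
      exact ⟨F, hF, hFq, fun ω hω h => hFD ω hω fun e he => (congrFun h ⟨e, he⟩).symm⟩
    · exact ⟨∅, fun _ _ _ h => h, by simpa using hq, fun ω hω h' => h ⟨ω, hω, h'⟩⟩
  choose F hF hFq hFD using hD'
  obtain ⟨B', rfl⟩ := hB.exists_preimage
  have hdet : ∀ θ : S → Bool, DeterminedBy S (S.restrict ⁻¹' {θ}) := by
    intro θ ω ω' h hω
    simp only [Set.mem_preimage, Set.mem_singleton_iff] at hω ⊢
    rw [← hω]
    exact funext fun e => (h e e.2).symm
  have hsub : D ⊆ ⋃ θ ∈ Finset.univ.filter (· ∈ B'), (S.restrict ⁻¹' {θ}) ∩ F θ := by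
    intro ω hω
    simp only [Finset.mem_filter, Finset.mem_univ, true_and, Set.mem_iUnion]
    exact ⟨S.restrict ω, hDB hω, rfl, hFD _ ω hω rfl⟩
  have hB'eq : S.restrict ⁻¹' B' =
      ⋃ θ ∈ Finset.univ.filter (· ∈ B'), (S.restrict (π := fun _ : E => Bool)) ⁻¹' {θ} := by
    ext ω; simp
  calc (percolation c).real D
      ≤ (percolation c).real (⋃ θ ∈ Finset.univ.filter (· ∈ B'), (S.restrict ⁻¹' {θ}) ∩ F θ) :=
        measureReal_mono hsub (measure_ne_top _ _)
    _ ≤ ∑ θ ∈ Finset.univ.filter (· ∈ B'),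
          (percolation c).real ((S.restrict ⁻¹' {θ}) ∩ F θ) := measureReal_biUnion_finset_le _ _
    _ ≤ ∑ θ ∈ Finset.univ.filter (· ∈ B'), q * (percolation c).real (S.restrict ⁻¹' {θ}) := by
        refine Finset.sum_le_sum fun θ _ => ?_
        rw [percolation_inter hST (hdet θ) (hF θ), mul_comm]
        exact mul_le_mul_of_nonneg_right (hFq θ) measureReal_nonneg
    _ = q * (percolation c).real (S.restrict ⁻¹' B') := by
        rw [← Finset.mul_sum, hB'eq, measureReal_biUnion_finset]
        · intro θ _ θ' _ hne
          exact Disjoint.preimage _ (by simpa using hne)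
        · exact fun θ _ => (hdet θ).measurableSet

end Percolation

section Clusters

/-- `x` and `y` are connected by open edges inside `[a, b)`; the edge between `u < v` is
indexed by `(u, v)`. -/
def Conn (ω : ℤ × ℤ → Bool) (a b : ℤ) : ℤ → ℤ → Prop :=
  Relation.EqvGen fun u v => a ≤ u ∧ u < v ∧ v < b ∧ ω (u, v) = true

/-- The edges inside `[a, b)`. -/
noncomputable def edgesIn (a b : ℤ) : Finset (ℤ × ℤ) :=
  (Finset.Ico a b ×ˢ Finset.Ico a b).filter fun e => e.1 < e.2

lemma mem_edgesIn {a b : ℤ} {e : ℤ × ℤ} : e ∈ edgesIn a b ↔ a ≤ e.1 ∧ e.1 < e.2 ∧ e.2 < b := by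
  simp only [edgesIn, Finset.mem_filter, Finset.mem_product, Finset.mem_Ico]
  omega

lemma Conn.mono {ω ω' : ℤ × ℤ → Bool} {a b a' b' x y : ℤ} (ha : a' ≤ a) (hb : b ≤ b')
    (hω : ∀ e ∈ edgesIn a b, ω e = true → ω' e = true) (h : Conn ω a b x y) :
    Conn ω' a' b' x y := by
  refine Relation.EqvGen.mono ?_ _ _ h
  rintro u v ⟨h1, h2, h3, h4⟩
  exact ⟨by omega, h2, by omega, hω (u, v) (mem_edgesIn.2 ⟨h1, h2, h3⟩) h4⟩

/-- There is a connected set inside `[a, b)` missing at most `k` of its sites. -/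
def HasCluster (ω : ℤ × ℤ → Bool) (a b : ℤ) (k : ℕ) : Prop :=
  ∃ A ⊆ Finset.Ico a b, (∀ x ∈ A, ∀ y ∈ A, Conn ω a b x y) ∧ (Finset.Ico a b \ A).card ≤ k

lemma HasCluster.congr {ω ω' : ℤ × ℤ → Bool} {a b : ℤ} {k : ℕ}
    (h : ∀ e ∈ edgesIn a b, ω e = ω' e) (hω : HasCluster ω a b k) : HasCluster ω' a b k := by
  obtain ⟨A, hA, hc, hk⟩ := hω
  exact ⟨A, hA, fun x hx y hy => (hc x hx y hy).mono le_rfl le_rfl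
    (fun e he h' => by rw [← h e he, h']), hk⟩

lemma determinedBy_not_hasCluster (a b : ℤ) (k : ℕ) :
    DeterminedBy (edgesIn a b) {ω | ¬ HasCluster ω a b k} :=
  fun _ _ h hω hω' => hω (hω'.congr fun e he => (h e he).symm)

lemma determinedBy_conn (a b x y : ℤ) : DeterminedBy (edgesIn a b) {ω | Conn ω a b x y} :=
  fun _ _ h hω => Conn.mono le_rfl le_rfl (fun e he h' => by rw [← h e he, h']) hω

/-- A set joining the clusters of `r` successive overlapping blocks of length `2 * h`. -/
structure IsChain (ω : ℤ × ℤ → Bool) (a : ℤ) (h k r : ℕ) (U : Finset ℤ) : Prop where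
  subset : U ⊆ Finset.Ico a (a + (r + 1) * h)
  conn : ∀ x ∈ U, ∀ y ∈ U, Conn ω a (a + (r + 1) * h) x y
  missing : ∀ i : ℕ, i < r → (Finset.Ico (a + i * h) (a + (i + 2) * h) \ U).card ≤ k

lemma exists_isChain {ω : ℤ × ℤ → Bool} {a : ℤ} {h k : ℕ} (hk : 2 * k < h) (r : ℕ)
    (hg : ∀ i : ℕ, i < r → HasCluster ω (a + i * h) (a + (i + 2) * h) k) :
    ∃ U, IsChain ω a h k r U := by
  induction r with
  | zero => exact ⟨∅, by simp, by simp, by simp⟩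
  | succ r ih =>
    obtain ⟨U, hU⟩ := ih fun i hi => hg i (by omega)
    obtain ⟨A, hA, hAc, hAk⟩ := hg r (by omega)
    have hr0 : (0 : ℤ) ≤ r * h := by positivity
    rcases Nat.eq_zero_or_pos r with rfl | hr
    · simp only [Nat.cast_zero, zero_mul, add_zero, zero_add] at hA hAc hAk
      refine ⟨A, ?_, ?_, fun i hi => ?_⟩
      · simpa [one_add_one_eq_two] using hA
      · simpa [one_add_one_eq_two] using hAc
      · obtain rfl : i = 0 := by omega
        simpa using hAk
    have hUsub : U ⊆ Finset.Ico a (a + ((r + 1 : ℕ) + 1) * h) := hU.subset.trans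
      (Finset.Ico_subset_Ico_right (by push_cast; nlinarith))
    have hAsub : A ⊆ Finset.Ico a (a + ((r + 1 : ℕ) + 1) * h) := hA.trans
      (Finset.Ico_subset_Ico (by linarith) (by push_cast; linarith))
    have hUconn : ∀ x ∈ U, ∀ y ∈ U, Conn ω a (a + ((r + 1 : ℕ) + 1) * h) x y := fun x hx y hy =>
      (hU.conn x hx y hy).mono le_rfl (by push_cast; nlinarith) fun _ _ h => h
    have hAconn : ∀ x ∈ A, ∀ y ∈ A, Conn ω a (a + ((r + 1 : ℕ) + 1) * h) x y := fun x hx y hy =>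
      (hAc x hx y hy).mono (by linarith) (by push_cast; linarith) fun _ _ h => h
    obtain ⟨z, hzU, hzA⟩ : ∃ z, z ∈ U ∧ z ∈ A := by
      by_contra! hno
      have hcov : Finset.Ico (a + r * h) (a + (r + 1) * h) ⊆
          (Finset.Ico (a + (r - 1 : ℕ) * h) (a + ((r - 1 : ℕ) + 2) * h) \ U) ∪
            (Finset.Ico (a + r * h) (a + (r + 2) * h) \ A) := by
        intro z hz
        rw [Finset.mem_Ico] at hz
        rw [Finset.mem_union, Finset.mem_sdiff, Finset.mem_sdiff, Finset.mem_Ico,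
          Finset.mem_Ico]
        have e1 : ((r - 1 : ℕ) : ℤ) = r - 1 := by push_cast [hr]; ring
        rw [e1]
        by_cases hzU : z ∈ U
        · exact Or.inr ⟨⟨hz.1, by nlinarith⟩, hno z hzU⟩
        · exact Or.inl ⟨⟨by nlinarith, by linarith⟩, hzU⟩
      have h1 := (Finset.card_le_card hcov).trans (Finset.card_union_le _ _)
      have h2 := hU.missing (r - 1) (by omega)
      have h3 : (Finset.Ico (a + r * h) (a + (r + 1) * h : ℤ)).card = h := by
        rw [Int.card_Ico]
        have : a + ((r : ℤ) + 1) * h - (a + r * h) = h := by ring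
        rw [this, Int.toNat_natCast]
      omega
    have hmeet : ∀ x ∈ U, ∀ y ∈ A, Conn ω a (a + ((r + 1 : ℕ) + 1) * h) x y :=
      fun x hx y hy => (hUconn x hx z hzU).trans _ _ _ (hAconn z hzA y hy)
    refine ⟨U ∪ A, Finset.union_subset hUsub hAsub, fun x hx y hy => ?_, fun i hi => ?_⟩
    · rcases Finset.mem_union.1 hx with hx | hx <;> rcases Finset.mem_union.1 hy with hy | hy
      · exact hUconn x hx y hy
      · exact hmeet x hx y hy
      · exact (hmeet y hy x hx).symm _ _
      · exact hAconn x hx y hy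
    · rcases Nat.lt_succ_iff_lt_or_eq.1 hi with hi | rfl
      · exact (Finset.card_le_card (Finset.sdiff_subset_sdiff le_rfl
          Finset.subset_union_left)).trans (hU.missing i hi)
      · exact (Finset.card_le_card (Finset.sdiff_subset_sdiff le_rfl
          Finset.subset_union_right)).trans hAk

lemma IsChain.two_mul_missing_le {ω : ℤ × ℤ → Bool} {a : ℤ} {h k r : ℕ} {U : Finset ℤ}
    (hU : IsChain ω a h k r U) :
    2 * (Finset.Ico a (a + (r + 1) * h) \ U).card ≤ (r + 2) * k + 2 * h := by
  rcases Nat.eq_zero_or_pos r with rfl | hr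
  · have : (Finset.Ico a (a + h) \ U).card ≤ h :=
      (Finset.card_le_card Finset.sdiff_subset).trans (by simp)
    simp only [Nat.cast_zero, zero_add, one_mul]
    omega
  have key : ∀ n : ℕ, n ≤ r →
      2 * (Finset.Ico a (a + (n + 1) * h) \ U).card ≤ (n + 2) * k := by
    intro n
    induction n using Nat.twoStepInduction with
    | zero =>
      intro _
      have h1 := hU.missing 0 hr
      have h2 : (Finset.Ico a (a + h) \ U).card ≤ k := by
        refine le_trans (Finset.card_le_card (Finset.sdiff_subset_sdiff ?_ le_rfl)) h1
        refine Finset.Ico_subset_Ico (by simp) ?_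
        push_cast; linarith
      simp only [Nat.cast_zero, zero_add, one_mul]
      omega
    | one =>
      intro _
      have h1 := hU.missing 0 hr
      simp only [Nat.cast_zero, zero_mul, add_zero, zero_add] at h1
      simp only [Nat.cast_one, one_add_one_eq_two]
      omega
    | more n ih _ =>
      intro hn
      have h1 := hU.missing (n + 1) (by omega)
      have h2 := ih (by omega)
      have hcov : Finset.Ico a (a + ((n + 2 : ℕ) + 1) * h) \ U ⊆
          (Finset.Ico a (a + (n + 1) * h) \ U) ∪
            (Finset.Ico (a + (n + 1 : ℕ) * h) (a + ((n + 1 : ℕ) + 2) * h) \ U) := by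
        intro z
        simp only [Finset.mem_union, Finset.mem_sdiff, Finset.mem_Ico]
        push_cast
        rintro ⟨⟨hz1, hz2⟩, hzU⟩
        rcases lt_or_ge z (a + (n + 1) * h) with hz | hz
        · exact Or.inl ⟨⟨hz1, hz⟩, hzU⟩
        · exact Or.inr ⟨⟨hz, by linarith⟩, hzU⟩
      have h3 := (Finset.card_le_card hcov).trans (Finset.card_union_le _ _)
      nlinarith
  have := key r le_rfl
  omega

end Clusters

section Renormalization

lemma hasCluster_of_subinterval {ω : ℤ × ℤ → Bool} {a b u v : ℤ} {k : ℕ} {U : Finset ℤ}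
    (hau : a ≤ u) (hvb : v ≤ b) (hU : U ⊆ Finset.Ico u v)
    (hc : ∀ x ∈ U, ∀ y ∈ U, Conn ω u v x y)
    (hk : ((Finset.Ico u v \ U).card : ℤ) + (u - a) + (b - v) ≤ k) : HasCluster ω a b k := by
  refine ⟨U, hU.trans (Finset.Ico_subset_Ico hau hvb), fun x hx y hy =>
    (hc x hx y hy).mono hau hvb fun _ _ h => h, ?_⟩
  have hcov : Finset.Ico a b \ U ⊆
      (Finset.Ico u v \ U) ∪ (Finset.Ico a u ∪ Finset.Ico v b) := by
    intro z
    simp only [Finset.mem_union, Finset.mem_sdiff, Finset.mem_Ico]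
    rintro ⟨⟨h1, h2⟩, h3⟩
    by_cases h4 : u ≤ z
    · by_cases h5 : z < v
      · exact Or.inl ⟨⟨h4, h5⟩, h3⟩
      · exact Or.inr (Or.inr ⟨by omega, h2⟩)
    · exact Or.inr (Or.inl ⟨h1, by omega⟩)
  have h1 := (Finset.card_le_card hcov).trans (Finset.card_union_le _ _)
  have h2 := Finset.card_union_le (Finset.Ico a u) (Finset.Ico v b)
  rw [Int.card_Ico, Int.card_Ico] at h2
  omega

lemma hasCluster_of_join {ω : ℤ × ℤ → Bool} {a h n : ℤ} {i r h' k k' : ℕ} {U V : Finset ℤ}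
    (hh : h = h') (hn : n = i + r + 3)
    (hU : IsChain ω a h' k i U) (hV : IsChain ω (a + (i + 2) * h) h' k r V)
    (hjoin : ∃ x ∈ U, ∃ y ∈ V, ω (x, y) = true)
    (hk : (n + 1) * k + 6 * h ≤ 2 * k') : HasCluster ω a (a + n * h) k' := by
  subst hh
  have hh0 : (0 : ℤ) ≤ h' := by positivity
  have hi0 : (0 : ℤ) ≤ i * h' := by positivity
  have hr0 : (0 : ℤ) ≤ r * h' := by positivity
  have hend : a + ((i : ℤ) + 2) * h' + (r + 1) * h' = a + n * h' := by rw [hn]; ring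
  obtain ⟨x₀, hx₀, y₀, hy₀, hopen⟩ := hjoin
  have hVs := hV.subset
  rw [hend] at hVs
  have hUc : ∀ x ∈ U, ∀ y ∈ U, Conn ω a (a + n * h') x y := fun x hx y hy =>
    (hU.conn x hx y hy).mono le_rfl (by rw [hn]; nlinarith) fun _ _ h => h
  have hVc : ∀ x ∈ V, ∀ y ∈ V, Conn ω a (a + n * h') x y := fun x hx y hy =>
    (hV.conn x hx y hy).mono (by nlinarith) (by rw [hend]) fun _ _ h => h
  have h0 : Conn ω a (a + n * h') x₀ y₀ := by
    have h1 := Finset.mem_Ico.1 (hU.subset hx₀)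
    have h2 := Finset.mem_Ico.1 (hVs hy₀)
    exact Relation.EqvGen.rel _ _ ⟨h1.1, by nlinarith, h2.2, hopen⟩
  have hUV : ∀ x ∈ U, ∀ y ∈ V, Conn ω a (a + n * h') x y := fun x hx y hy =>
    ((hUc x hx x₀ hx₀).trans _ _ _ h0).trans _ _ _ (hVc y₀ hy₀ y hy)
  refine ⟨U ∪ V, Finset.union_subset (hU.subset.trans (Finset.Ico_subset_Ico_right ?_))
    (hVs.trans (Finset.Ico_subset_Ico_left ?_)), fun x hx y hy => ?_, ?_⟩
  · rw [hn]; nlinarith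
  · nlinarith
  · rcases Finset.mem_union.1 hx with hx | hx <;> rcases Finset.mem_union.1 hy with hy | hy
    · exact hUc x hx y hy
    · exact hUV x hx y hy
    · exact (hUV y hy x hx).symm _ _
    · exact hVc x hx y hy
  · have hcov : Finset.Ico a (a + n * h') \ (U ∪ V) ⊆
        (Finset.Ico a (a + (i + 1) * h') \ U) ∪
          ((Finset.Ico (a + (i + 1) * h') (a + (i + 2) * h')) ∪
          (Finset.Ico (a + (i + 2) * h') (a + (i + 2) * h' + (r + 1) * h') \ V)) := by
      intro z
      rw [hend]
      simp only [Finset.mem_union, Finset.mem_sdiff, Finset.mem_Ico, not_or]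
      rintro ⟨⟨h1, h2⟩, h3, h4⟩
      by_cases h5 : z < a + (i + 1) * h'
      · exact Or.inl ⟨⟨h1, h5⟩, h3⟩
      · by_cases h6 : z < a + (i + 2) * h'
        · exact Or.inr (Or.inl ⟨by omega, h6⟩)
        · exact Or.inr (Or.inr ⟨⟨by omega, h2⟩, h4⟩)
    have h1 := (Finset.card_le_card hcov).trans (Finset.card_union_le _ _)
    have h2 := Finset.card_union_le (Finset.Ico (a + (i + 1) * h') (a + (i + 2) * (h' : ℤ)))
      (Finset.Ico (a + (i + 2) * h') (a + (i + 2) * h' + (r + 1) * h') \ V)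
    have h3 : (Finset.Ico (a + (i + 1) * h') (a + (i + 2) * (h' : ℤ))).card = h' := by
      rw [Int.card_Ico]
      have : a + ((i : ℤ) + 2) * h' - (a + (i + 1) * h') = h' := by ring
      rw [this, Int.toNat_natCast]
    have h4 := hU.two_mul_missing_le
    have h5 := hV.two_mul_missing_le
    rw [hn] at hk
    zify at h1 h2 h3 h4 h5 ⊢
    nlinarith

/-- The event of a scale failing because of a single defect at block `i`, all the blocks which
do not meet it being good. -/
def singleDefect (a : ℤ) (h k C k' i : ℕ) : Set (ℤ × ℤ → Bool) :=
  {ω | ¬ HasCluster ω a (a + (2 * C : ℕ) * h) k' ∧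
    ¬ HasCluster ω (a + i * h) (a + (i + 2) * h) k ∧
    (∀ j : ℕ, j < i → HasCluster ω (a + j * h) (a + (j + 2) * h) k) ∧
    ∀ j : ℕ, i + 2 ≤ j → j + 1 < 2 * C → HasCluster ω (a + j * h) (a + (j + 2) * h) k}

lemma exists_defect {ω : ℤ × ℤ → Bool} {a : ℤ} {h k C s : ℕ} (hk : 2 * k < h) (hC : 1 ≤ C)
    (hω : ¬ HasCluster ω a (a + (2 * C : ℕ) * h) (C * k + (2 * s + 4) * h)) :
    (∃ i j : ℕ, i + 2 ≤ j ∧ j + 1 < 2 * C ∧ ¬ HasCluster ω (a + i * h) (a + (i + 2) * h) k ∧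
      ¬ HasCluster ω (a + j * h) (a + (j + 2) * h) k) ∨
    ∃ i : ℕ, 2 * s ≤ i ∧ i + 3 + 2 * s ≤ 2 * C ∧
      ω ∈ singleDefect a h k C (C * k + (2 * s + 4) * h) i := by
  classical
  have hbad : ∃ i : ℕ, i + 1 < 2 * C ∧ ¬ HasCluster ω (a + i * h) (a + (i + 2) * h) k := by
    by_contra! hno
    obtain ⟨U, hU⟩ := exists_isChain (ω := ω) (a := a) hk (2 * C - 1)
      fun i hi => hno i (by omega)
    refine hω (hasCluster_of_subinterval le_rfl (le_of_eq ?_) hU.subset hU.conn ?_)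
    · push_cast [show 1 ≤ 2 * C by omega]; ring
    · have h1 := hU.two_mul_missing_le
      have h2 : (2 * C - 1 + 2) * k = 2 * (C * k) + k := by
        rw [show 2 * C - 1 + 2 = 2 * C + 1 by omega]; ring
      have h3 : ((2 * C - 1 : ℕ) : ℤ) + 1 = (2 * C : ℕ) := by omega
      rw [h2] at h1
      rw [h3] at h1 ⊢
      have h4 : 4 * h ≤ (2 * s + 4) * h := Nat.mul_le_mul_right _ (by omega)
      push_cast at h1 ⊢
      zify at h1 h4 hk
      linarith
  set i := Nat.find hbad with hi
  obtain ⟨hi1, hi2⟩ := Nat.find_spec hbad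
  rw [← hi] at hi1 hi2
  have hleft : ∀ j : ℕ, j < i → HasCluster ω (a + j * h) (a + (j + 2) * h) k := fun j hj => by
    by_contra hc
    exact Nat.find_min hbad hj ⟨by omega, hc⟩
  by_cases hright : ∀ j : ℕ, i + 2 ≤ j → j + 1 < 2 * C →
      HasCluster ω (a + j * h) (a + (j + 2) * h) k
  swap
  · push Not at hright
    obtain ⟨j, hj1, hj2, hj3⟩ := hright
    exact Or.inl ⟨i, j, hj1, hj2, hi2, hj3⟩
  refine Or.inr ⟨i, ?_, ?_, hω, hi2, hleft, hright⟩
  · by_contra! his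
    refine hω ?_
    by_cases hi3 : i + 3 ≤ 2 * C
    · obtain ⟨r, hr⟩ := Nat.exists_eq_add_of_le hi3
      obtain ⟨V, hV⟩ := exists_isChain (ω := ω) (a := a + (i + 2) * h) hk r fun j hj => by
        have := hright (i + 2 + j) (by omega) (by omega)
        push_cast at this
        convert this using 1 <;> ring
      refine hasCluster_of_subinterval (by nlinarith) (le_of_eq ?_) hV.subset hV.conn ?_
      · rw [hr]; push_cast; ring
      · have h1 := hV.two_mul_missing_le
        have hr' : (2 * C : ℤ) = i + 3 + r := by exact_mod_cast hr
        have h2 : ((i : ℤ) + 1) * h ≤ 2 * s * h :=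
          mul_le_mul_of_nonneg_right (by exact_mod_cast his) (by positivity)
        have h3 : (2 * C : ℤ) * k = (i + 3 + r) * k := by rw [hr']
        have h4 : (0 : ℤ) ≤ i * k := by positivity
        have h5 : (2 * C : ℤ) * h = (i + 3 + r) * h := by rw [hr']
        push_cast
        zify at h1
        nlinarith
    · refine ⟨∅, by simp, by simp, ?_⟩
      have h2 : 2 * C * h ≤ (2 * s + 4) * h := Nat.mul_le_mul_right _ (by omega)
      simp only [Finset.sdiff_empty, Int.card_Ico, add_sub_cancel_left]
      have : (((2 * C : ℕ) : ℤ) * h).toNat = 2 * C * h := by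
        rw [← Nat.cast_mul, Int.toNat_natCast]
      rw [this]
      exact h2.trans (Nat.le_add_left _ _)
  · by_contra! his
    refine hω ?_
    obtain ⟨U, hU⟩ := exists_isChain (ω := ω) (a := a) hk i fun j hj => hleft j hj
    refine hasCluster_of_subinterval le_rfl ?_ hU.subset hU.conn ?_
    · have : ((i : ℤ) + 1) * h ≤ (2 * C : ℕ) * h :=
        mul_le_mul_of_nonneg_right (by exact_mod_cast (by omega : i + 1 ≤ 2 * C)) (by positivity)
      linarith
    · have h1 := hU.two_mul_missing_le
      have h2 : (2 * C : ℤ) * h ≤ (i + 2 * s + 2) * h :=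
        mul_le_mul_of_nonneg_right (by exact_mod_cast (by omega : 2 * C ≤ i + 2 * s + 2))
          (by positivity)
      have h3 : ((i : ℤ) + 2) * k ≤ 2 * C * k :=
        mul_le_mul_of_nonneg_right (by exact_mod_cast (by omega : i + 2 ≤ 2 * C)) (by positivity)
      push_cast
      zify at h1
      nlinarith

/-- One renormalization step. -/
lemma renormalization_step (c : ℤ × ℤ → NNReal) {h k C s : ℕ} (hk : 2 * k < h) (hC : 1 ≤ C)
    {p q : ℝ} (hq : 0 ≤ q)
    (hp : ∀ a : ℤ, (percolation c).real {ω | ¬ HasCluster ω a (a + 2 * h) k} ≤ p)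
    (hcross : ∀ (b : ℤ) (U V : Finset ℤ), (∀ x ∈ U, x < b) → (∀ y ∈ V, b + h ≤ y) →
      (∀ j : ℕ, j < s → (Finset.Ico (b - (2 * j + 2) * h) (b - 2 * j * h) \ U).card ≤ k) →
      (∀ l : ℕ, l < s → (Finset.Ico (b + h + 2 * l * h) (b + h + (2 * l + 2) * h) \ V).card ≤ k) →
      Real.exp (-∑ e ∈ U ×ˢ V, (c e : ℝ)) ≤ q) (a : ℤ) :
    (percolation c).real {ω | ¬ HasCluster ω a (a + 2 * (C * h : ℕ)) (C * k + (2 * s + 4) * h)} ≤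
      4 * C ^ 2 * p ^ 2 + 2 * C * (p * q) := by
  classical
  set K := C * k + (2 * s + 4) * h with hK
  set P := percolation c with hP
  have hp0 : 0 ≤ p := measureReal_nonneg.trans (hp 0)
  set bad : ℕ → Set (ℤ × ℤ → Bool) :=
    fun i => {ω | ¬ HasCluster ω (a + i * h) (a + (i + 2) * h) k} with hbaddef
  have hbad : ∀ i, P.real (bad i) ≤ p := fun i => by
    have := hp (a + i * h)
    rwa [show a + (i : ℤ) * h + 2 * h = a + (i + 2) * h by ring] at this
  have hbaddet : ∀ i : ℕ, DeterminedBy (edgesIn (a + i * h) (a + (i + 2) * h)) (bad i) :=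
    fun i => determinedBy_not_hasCluster _ _ _
  have hpair : ∀ i j : ℕ, i + 2 ≤ j → P.real (bad i ∩ bad j) ≤ p ^ 2 := by
    intro i j hij
    have hdisj : Disjoint (edgesIn (a + i * h) (a + (i + 2) * h))
        (edgesIn (a + j * h) (a + (j + 2) * h)) := by
      rw [Finset.disjoint_left]
      intro e he he'
      rw [mem_edgesIn] at he he'
      have : ((i : ℤ) + 2) * h ≤ j * h :=
        mul_le_mul_of_nonneg_right (by exact_mod_cast hij) (by positivity)
      linarith
    rw [hP, percolation_inter hdisj (hbaddet i) (hbaddet j), sq]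
    exact mul_le_mul (hbad i) (hbad j) measureReal_nonneg hp0
  have hsingle : ∀ i : ℕ, 2 * s ≤ i → i + 3 + 2 * s ≤ 2 * C →
      P.real (singleDefect a h k C K i) ≤ p * q := by
    intro i hi1 hi2
    obtain ⟨r, hr⟩ := Nat.exists_eq_add_of_le (show i + 3 ≤ 2 * C by omega)
    set m₁ : ℤ := a + (i + 1) * h with hm₁
    set m₂ : ℤ := a + (i + 2) * h with hm₂
    set z : ℤ := a + (2 * C : ℕ) * h with hz
    have hm12 : m₂ = m₁ + h := by rw [hm₁, hm₂]; ring
    have hzr : z = m₂ + (r + 1) * h := by rw [hz, hm₂, hr]; push_cast; ring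
    have hh0 : (0 : ℤ) < h := by exact_mod_cast (by omega : 0 < h)
    have hi0 : (0 : ℤ) ≤ i * h := by positivity
    have hr0 : (0 : ℤ) ≤ r * h := by positivity
    set S : Finset (ℤ × ℤ) := edgesIn a m₁ ∪ edgesIn m₂ z ∪ edgesIn (a + i * h) m₂ with hS
    set T : Finset (ℤ × ℤ) := Finset.Ico a m₁ ×ˢ Finset.Ico m₂ z with hT
    have hST : Disjoint S T := by
      rw [Finset.disjoint_left]
      intro e he he'
      simp only [hS, hT, Finset.mem_union, mem_edgesIn, Finset.mem_product, Finset.mem_Ico]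
        at he he'
      rcases he with (he | he) | he
      · linarith
      · linarith
      · linarith
    have hBdet : DeterminedBy S (bad i) := (hbaddet i).mono Finset.subset_union_right
    have hmain : P.real (singleDefect a h k C K i) ≤ q * P.real (bad i) := by
      refine percolation_le_mul hST hBdet (fun ω hω => hω.2.1) hq fun η hη => ?_
      obtain ⟨-, -, hηl, hηr⟩ := hη
      obtain ⟨U, hU⟩ := exists_isChain (ω := η) (a := a) hk i hηl
      obtain ⟨V, hV⟩ := exists_isChain (ω := η) (a := m₂) hk r fun j hj => by
        have := hηr (i + 2 + j) (by omega) (by omega)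
        push_cast at this
        convert this using 1 <;> rw [hm₂] <;> ring
      have hVs := hV.subset
      rw [← hzr] at hVs
      refine ⟨{ω | ∀ e ∈ U ×ˢ V, ω e = false}, ?_, ?_, ?_⟩
      · intro ω ω' hag hω e he
        rw [← hag e (Finset.product_subset_product hU.subset hVs he)]
        exact hω e he
      · rw [percolation_closed]
        refine hcross m₁ U V (fun x hx => (Finset.mem_Ico.1 (hU.subset hx)).2)
          (fun y hy => hm12 ▸ (Finset.mem_Ico.1 (hVs hy)).1) (fun j hj => ?_) (fun l hl => ?_)
        · have hj' : 2 * j + 1 ≤ i := by omega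
          have := hU.missing (i - (2 * j + 1)) (by omega)
          push_cast [hj'] at this
          convert this using 4 <;> rw [hm₁] <;> ring
        · have := hV.missing (2 * l) (by omega)
          push_cast at this
          convert this using 4 <;> rw [hm12]
      · intro ω hω hag e he
        by_contra hopen
        have hlift : ∀ e ∈ S, η e = true → ω e = true := fun e he h => by rw [← hag e he, h]
        have hU' : IsChain ω a h k i U := ⟨hU.subset, fun x hx y hy =>
          (hU.conn x hx y hy).mono le_rfl le_rfl fun e he => hlift e
            (Finset.mem_union_left _ (Finset.mem_union_left _ he)), hU.missing⟩
        have hV' : IsChain ω m₂ h k r V := ⟨hV.subset, fun x hx y hy =>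
          (hV.conn x hx y hy).mono le_rfl le_rfl fun e he => hlift e
            (Finset.mem_union_left _ (Finset.mem_union_right _ (by rwa [hzr]))), hV.missing⟩
        rw [Finset.mem_product] at he
        refine hω.1 (hasCluster_of_join rfl (by rw [hr]; push_cast; ring) hU' hV'
          ⟨e.1, he.1, e.2, he.2, by simpa using hopen⟩ ?_)
        rw [hK]
        push_cast
        have h1 : (0 : ℤ) ≤ s * h := by positivity
        zify at hk
        nlinarith
    calc P.real (singleDefect a h k C K i) ≤ q * P.real (bad i) := hmain
      _ ≤ q * p := mul_le_mul_of_nonneg_left (hbad i) hq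
      _ = p * q := mul_comm _ _
  set I := (Finset.range (2 * C) ×ˢ Finset.range (2 * C)).filter fun e => e.1 + 2 ≤ e.2 with hI
  set I' := (Finset.range (2 * C)).filter fun i => 2 * s ≤ i ∧ i + 3 + 2 * s ≤ 2 * C with hI'
  have hcov : {ω | ¬ HasCluster ω a (a + 2 * (C * h : ℕ)) K} ⊆
      (⋃ e ∈ I, bad e.1 ∩ bad e.2) ∪ ⋃ i ∈ I', singleDefect a h k C K i := by
    intro ω hω
    have hω' : ¬ HasCluster ω a (a + (2 * C : ℕ) * h) K := by
      have e1 : a + ((2 * C : ℕ) : ℤ) * h = a + 2 * (C * h : ℕ) := by push_cast; ring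
      rw [e1]; exact hω
    rcases exists_defect hk hC hω' with ⟨i, j, hij, hj, hbi, hbj⟩ | ⟨i, hi1, hi2, hi3⟩
    · refine Or.inl (Set.mem_biUnion (x := (i, j)) ?_ ⟨hbi, hbj⟩)
      simp only [hI, Finset.coe_filter, Finset.mem_product, Finset.mem_range, Set.mem_ofPred_eq]
      omega
    · refine Or.inr (Set.mem_biUnion (x := i) ?_ hi3)
      simp only [hI', Finset.coe_filter, Finset.mem_range, Set.mem_ofPred_eq]
      omega
  refine (measureReal_mono hcov (measure_ne_top _ _)).trans
    ((measureReal_union_le _ _).trans (add_le_add ?_ ?_))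
  · refine (measureReal_biUnion_finset_le _ _).trans ((Finset.sum_le_card_nsmul _ _ (p ^ 2)
      fun e he => hpair _ _ (Finset.mem_filter.1 he).2).trans ?_)
    have hcard : I.card ≤ (2 * C) * (2 * C) :=
      (Finset.card_filter_le _ _).trans (by simp)
    rw [nsmul_eq_mul]
    refine mul_le_mul_of_nonneg_right ?_ (sq_nonneg p)
    calc (I.card : ℝ) ≤ ((2 * C) * (2 * C) : ℕ) := by exact_mod_cast hcard
      _ = 4 * C ^ 2 := by push_cast; ring
  · refine (measureReal_biUnion_finset_le _ _).trans ((Finset.sum_le_card_nsmul _ _ (p * q)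
      fun i hi => hsingle _ (Finset.mem_filter.1 hi).2.1 (Finset.mem_filter.1 hi).2.2).trans ?_)
    have hcard : I'.card ≤ 2 * C := (Finset.card_filter_le _ _).trans (by simp)
    rw [nsmul_eq_mul]
    refine mul_le_mul_of_nonneg_right ?_ (mul_nonneg hp0 hq)
    exact_mod_cast hcard

end Renormalization

section CrossEdges

lemma log_sub_le_sum_inv_sq (s : ℕ) :
    Real.log (s + 3) - Real.log 3 - 1 ≤
      ∑ j ∈ Finset.range s, ∑ l ∈ Finset.range s, 1 / ((j : ℝ) + l + 3) ^ 2 := by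
  have hinner : ∀ j : ℕ, ∀ n : ℕ, 1 / ((j : ℝ) + 3) - 1 / ((j : ℝ) + n + 3) ≤
      ∑ l ∈ Finset.range n, 1 / ((j : ℝ) + l + 3) ^ 2 := by
    intro j n
    induction n with
    | zero => simp
    | succ n ih =>
      rw [Finset.sum_range_succ]
      have h : 1 / ((j : ℝ) + n + 3) - 1 / ((j : ℝ) + (n + 1 : ℕ) + 3) ≤
          1 / ((j : ℝ) + n + 3) ^ 2 := by
        push_cast
        rw [div_sub_div _ _ (by positivity) (by positivity), div_le_div_iff₀ (by positivity)
          (by positivity)]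
        have : (0 : ℝ) < j + n + 3 := by positivity
        nlinarith
      linarith
  have hlog : ∀ n : ℕ, Real.log (n + 3) - Real.log 3 ≤
      ∑ j ∈ Finset.range n, 1 / ((j : ℝ) + 3) := by
    intro n
    induction n with
    | zero => simp
    | succ n ih =>
      rw [Finset.sum_range_succ]
      have h : Real.log ((n + 1 : ℕ) + 3) - Real.log (n + 3) ≤ 1 / ((n : ℝ) + 3) := by
        rw [← Real.log_div (by positivity) (by positivity)]
        refine (Real.log_le_sub_one_of_pos (by positivity)).trans (le_of_eq ?_)
        push_cast
        field_simp
        ring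
      linarith
  have hsum : ∑ j ∈ Finset.range s, 1 / ((j : ℝ) + s + 3) ≤ 1 := by
    have h1 : ∀ j ∈ Finset.range s, 1 / ((j : ℝ) + s + 3) ≤ 1 / ((s : ℝ) + 3) := fun j _ =>
      one_div_le_one_div_of_le (by positivity) (by linarith [(Nat.cast_nonneg j : (0 : ℝ) ≤ j)])
    refine (Finset.sum_le_sum h1).trans ?_
    rw [Finset.sum_const, Finset.card_range, nsmul_eq_mul, mul_one_div, div_le_one (by positivity)]
    linarith
  have := Finset.sum_le_sum fun j (_ : j ∈ Finset.range s) => hinner j s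
  rw [Finset.sum_sub_distrib] at this
  linarith [hlog s]

lemma cross_energy_ge {c : ℤ × ℤ → NNReal} {β : ℝ} (hβ : 0 ≤ β)
    (hc : ∀ u v : ℤ, u + 2 ≤ v → β / ((v - u : ℤ) : ℝ) ^ 2 ≤ c (u, v)) {h k s : ℕ} (hk : 2 * k < h)
    {b : ℤ} {U V : Finset ℤ} (hUb : ∀ x ∈ U, x < b) (hVb : ∀ y ∈ V, b + h ≤ y)
    (hU : ∀ j : ℕ, j < s → (Finset.Ico (b - (2 * j + 2) * h) (b - 2 * j * h) \ U).card ≤ k)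
    (hV : ∀ l : ℕ, l < s →
      (Finset.Ico (b + h + 2 * l * h) (b + h + (2 * l + 2) * h) \ V).card ≤ k) :
    β * (1 - k / (2 * h)) ^ 2 * (∑ j ∈ Finset.range s, ∑ l ∈ Finset.range s,
      1 / ((j : ℝ) + l + 3) ^ 2) ≤ ∑ e ∈ U ×ˢ V, (c e : ℝ) := by
  classical
  have hh0 : (0 : ℤ) < h := by exact_mod_cast (by omega : 0 < h)
  have hhR : (0 : ℝ) < h := by exact_mod_cast hh0
  set A : ℕ → Finset ℤ := fun j => Finset.Ico (b - (2 * j + 2) * h) (b - 2 * j * h) with hA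
  set B : ℕ → Finset ℤ := fun l => Finset.Ico (b + h + 2 * l * h) (b + h + (2 * l + 2) * h) with hB
  set R := Finset.range s ×ˢ Finset.range s with hR
  have hAcard : ∀ j, (A j).card = 2 * h := fun j => by
    rw [hA, Int.card_Ico, show b - 2 * (j : ℤ) * h - (b - (2 * j + 2) * h) = (2 * h : ℕ) by
      push_cast; ring, Int.toNat_natCast]
  have hBcard : ∀ j, (B j).card = 2 * h := fun j => by
    rw [hB, Int.card_Ico, show b + (h : ℤ) + (2 * j + 2) * h - (b + h + 2 * j * h) = (2 * h : ℕ) by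
      push_cast; ring, Int.toNat_natCast]
  have hlt : ∀ i j : ℕ, i < j → (i + 1 : ℤ) * h ≤ j * h := fun i j hij =>
    mul_le_mul_of_nonneg_right (by exact_mod_cast hij) hh0.le
  have hAdisj : ∀ i j x, x ∈ A i → x ∈ A j → i = j := by
    intro i j x hi hj
    simp only [hA, Finset.mem_Ico] at hi hj
    rcases lt_trichotomy i j with h | h | h
    · nlinarith [hlt _ _ h]
    · exact h
    · nlinarith [hlt _ _ h]
  have hBdisj : ∀ i j x, x ∈ B i → x ∈ B j → i = j := by
    intro i j x hi hj
    simp only [hB, Finset.mem_Ico] at hi hj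
    rcases lt_trichotomy i j with h | h | h
    · nlinarith [hlt _ _ h]
    · exact h
    · nlinarith [hlt _ _ h]
  have hsub : R.biUnion (fun e => (A e.1 ∩ U) ×ˢ (B e.2 ∩ V)) ⊆ U ×ˢ V := by
    intro e he
    simp only [Finset.mem_biUnion, Finset.mem_product, Finset.mem_inter] at he ⊢
    obtain ⟨_, _, h1, h2⟩ := he
    exact ⟨h1.2, h2.2⟩
  have hdisj : (R : Set (ℕ × ℕ)).PairwiseDisjoint
      (fun e => (A e.1 ∩ U) ×ˢ (B e.2 ∩ V)) := by
    intro e _ e' _ hne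
    rw [Function.onFun, Finset.disjoint_left]
    intro z hz hz'
    simp only [Finset.mem_product, Finset.mem_inter] at hz hz'
    exact hne (Prod.ext (hAdisj _ _ _ hz.1.1 hz'.1.1) (hBdisj _ _ _ hz.2.1 hz'.2.1))
  have hfiber : ∀ e ∈ R, β * (1 - k / (2 * h)) ^ 2 * (1 / ((e.1 : ℝ) + e.2 + 3) ^ 2) ≤
      ∑ z ∈ (A e.1 ∩ U) ×ˢ (B e.2 ∩ V), (c z : ℝ) := by
    rintro ⟨j, l⟩ he
    simp only [hR, Finset.mem_product, Finset.mem_range] at he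
    have hcU : 2 * h - k ≤ (A j ∩ U).card := by
      have h1 := Finset.card_sdiff_add_card_inter (A j) U
      have h2 := hU j he.1
      have h3 := hAcard j
      simp only [hA] at h1 h3 ⊢
      omega
    have hcV : 2 * h - k ≤ (B l ∩ V).card := by
      have h1 := Finset.card_sdiff_add_card_inter (B l) V
      have h2 := hV l he.2
      have h3 := hBcard l
      simp only [hB] at h1 h3 ⊢
      omega
    have hterm : ∀ z ∈ (A j ∩ U) ×ˢ (B l ∩ V),
        β / ((2 * ((j : ℝ) + l + 3)) * h) ^ 2 ≤ c z := by
      rintro ⟨u, v⟩ hz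
      simp only [Finset.mem_product, Finset.mem_inter, hA, hB, Finset.mem_Ico] at hz
      obtain ⟨⟨hu, huU⟩, hv, hvV⟩ := hz
      have h1 := hUb u huU
      have h2 := hVb v hvV
      refine le_trans ?_ (hc u v (by omega))
      have h3 : (0 : ℝ) < ((v - u : ℤ) : ℝ) := by exact_mod_cast (by omega : 0 < v - u)
      refine div_le_div_of_nonneg_left hβ (by positivity) (pow_le_pow_left₀ h3.le ?_ 2)
      have h4 : v - u ≤ (2 * (j + l + 3)) * h := by nlinarith
      exact_mod_cast h4
    have hnn : 0 ≤ β / ((2 * ((j : ℝ) + l + 3)) * h) ^ 2 := by positivity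
    have h1 := Finset.card_nsmul_le_sum _ _ _ hterm
    rw [Finset.card_product, nsmul_eq_mul] at h1
    refine le_trans ?_ h1
    have hcast : (2 * h - k : ℝ) ^ 2 ≤ (((A j ∩ U).card * (B l ∩ V).card : ℕ) : ℝ) := by
      rw [sq]
      push_cast
      have h5 : (2 * h - k : ℝ) ≤ ((A j ∩ U).card : ℝ) := by
        have : 2 * h ≤ (A j ∩ U).card + k := by omega
        have : (2 * h : ℝ) ≤ (A j ∩ U).card + k := by exact_mod_cast this
        linarith
      have h6 : (2 * h - k : ℝ) ≤ ((B l ∩ V).card : ℝ) := by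
        have : 2 * h ≤ (B l ∩ V).card + k := by omega
        have : (2 * h : ℝ) ≤ (B l ∩ V).card + k := by exact_mod_cast this
        linarith
      have h7 : (0 : ℝ) ≤ 2 * h - k := by
        have : (2 * k : ℝ) < h := by exact_mod_cast hk
        linarith
      exact mul_le_mul h5 h6 h7 (Nat.cast_nonneg _)
    refine le_trans (le_of_eq ?_) (mul_le_mul_of_nonneg_right hcast hnn)
    field_simp
  calc β * (1 - k / (2 * h)) ^ 2 * (∑ j ∈ Finset.range s, ∑ l ∈ Finset.range s,
      1 / ((j : ℝ) + l + 3) ^ 2)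
      = ∑ e ∈ R, β * (1 - k / (2 * h)) ^ 2 * (1 / ((e.1 : ℝ) + e.2 + 3) ^ 2) := by
        rw [← Finset.mul_sum, hR, Finset.sum_product]
    _ ≤ ∑ e ∈ R, ∑ z ∈ (A e.1 ∩ U) ×ˢ (B e.2 ∩ V), (c z : ℝ) := Finset.sum_le_sum hfiber
    _ = ∑ z ∈ R.biUnion (fun e => (A e.1 ∩ U) ×ˢ (B e.2 ∩ V)), (c z : ℝ) :=
        (Finset.sum_biUnion hdisj).symm
    _ ≤ ∑ e ∈ U ×ˢ V, (c e : ℝ) :=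
        Finset.sum_le_sum_of_subset_of_nonneg hsub fun _ _ _ => NNReal.coe_nonneg _

end CrossEdges

section Scales

lemma percolation_not_hasCluster_two_le (c : ℤ × ℤ → NNReal) (a : ℤ) :
    (percolation c).real {ω | ¬ HasCluster ω a (a + 2) 0} ≤ Real.exp (-c (a, a + 1)) := by
  have h := percolation_closed c {(a, a + 1)}
  rw [Finset.sum_singleton] at h
  rw [← h]
  refine measureReal_mono (fun ω hω => ?_) (measure_ne_top _ _)
  simp only [Finset.mem_singleton, forall_eq, Set.mem_ofPred_eq] at hω ⊢
  by_contra hne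
  refine hω ⟨Finset.Ico a (a + 2), subset_rfl, ?_, by simp⟩
  have hedge : Conn ω a (a + 2) a (a + 1) :=
    Relation.EqvGen.rel _ _ ⟨le_rfl, by omega, by omega, by simpa using hne⟩
  intro x hx y hy
  rw [Finset.mem_Ico] at hx hy
  have hxa : x = a ∨ x = a + 1 := by omega
  have hya : y = a ∨ y = a + 1 := by omega
  rcases hxa with rfl | rfl <;> rcases hya with rfl | rfl
  · exact Relation.EqvGen.refl _
  · exact hedge
  · exact hedge.symm
  · exact Relation.EqvGen.refl _

lemma percolation_not_hasCluster_step {c : ℤ × ℤ → NNReal} {β γ : ℝ} (hβ : 0 ≤ β) (hγ : 0 ≤ γ)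
    (hc : ∀ u v : ℤ, u + 2 ≤ v → β / ((v - u : ℤ) : ℝ) ^ 2 ≤ c (u, v)) {h k C s : ℕ}
    (hk : 2 * k < h) (hC : 1 ≤ C) (hs : 1 ≤ s) (hkγ : γ ≤ β * (1 - k / (2 * h)) ^ 2) {p : ℝ}
    (hp : ∀ a : ℤ, (percolation c).real {ω | ¬ HasCluster ω a (a + 2 * h) k} ≤ p) (a : ℤ) :
    (percolation c).real {ω | ¬ HasCluster ω a (a + 2 * (C * h : ℕ)) (C * k + (2 * s + 4) * h)} ≤
      4 * C ^ 2 * p ^ 2 + 2 * C * (p * (Real.exp (γ * (Real.log 3 + 1)) * (s : ℝ) ^ (-γ))) := by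
  refine renormalization_step c hk hC (by positivity) hp (fun b U V hUb hVb hU hV => ?_) a
  have h1 := cross_energy_ge hβ hc hk hUb hVb hU hV
  have h2 := log_sub_le_sum_inv_sq s
  have hs0 : (0 : ℝ) < s := by exact_mod_cast hs
  have h3 : Real.log s ≤ Real.log (s + 3) := Real.log_le_log hs0 (by linarith)
  have h4 : 0 ≤ ∑ j ∈ Finset.range s, ∑ l ∈ Finset.range s, 1 / ((j : ℝ) + l + 3) ^ 2 :=
    Finset.sum_nonneg fun _ _ => Finset.sum_nonneg fun _ _ => by positivity
  rw [Real.rpow_def_of_pos hs0, ← Real.exp_add]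
  refine Real.exp_le_exp.2 ?_
  have h5 := mul_le_mul_of_nonneg_right hkγ h4
  have h6 := mul_le_mul_of_nonneg_left (h3.trans (by linarith [h2] : Real.log (s + 3) ≤
    (∑ j ∈ Finset.range s, ∑ l ∈ Finset.range s, 1 / ((j : ℝ) + l + 3) ^ 2) + (Real.log 3 + 1))) hγ
  linarith

/-- The block lengths `h` of the renormalization, with growth factors `C n`. -/
def blockLength (C : ℕ → ℕ) : ℕ → ℕ
  | 0 => 1
  | n + 1 => C n * blockLength C n

/-- The number of sites a good block of length `2 * h` may miss. -/
def blockDefect (C s : ℕ → ℕ) : ℕ → ℕ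
  | 0 => 0
  | n + 1 => C n * blockDefect C s n + (2 * s n + 4) * blockLength C n

lemma exists_blockLength_le {C : ℕ → ℕ} (hC : ∀ n, 2 ≤ C n) {L : ℕ} (hL : 1 ≤ L) :
    ∃ n, blockLength C n ≤ L ∧ L < C n * blockLength C n := by
  have hgrow : ∀ n, n < blockLength C n := by
    intro n
    induction n with
    | zero => simp [blockLength]
    | succ n ih =>
      simp only [blockLength]
      nlinarith [hC n]
  have hex : ∃ n, L < blockLength C n := ⟨L, hgrow L⟩
  classical
  obtain ⟨n, hn⟩ : ∃ n, Nat.find hex = n + 1 := by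
    refine Nat.exists_eq_succ_of_ne_zero fun h0 => ?_
    have := Nat.find_spec hex
    rw [h0] at this
    simp only [blockLength] at this
    omega
  refine ⟨n, not_lt.1 (Nat.find_min hex (by omega)), ?_⟩
  have := Nat.find_spec hex
  rwa [hn] at this

/-- Growth factors for which the renormalization closes. -/
lemma exists_growth {γ μ : ℝ} (hγ : 1 < γ) (hμ : 0 < μ) (K : ℝ) (hK : 0 ≤ K) :
    ∃ B D s₀ : ℕ, 1 ≤ B ∧ 12 ≤ μ * D ∧ 1 ≤ D ∧ 1 ≤ s₀ ∧
      ∀ n : ℕ, ((D * s₀ * (2 * B) ^ n : ℕ) : ℝ) * (K * ((s₀ * B ^ n : ℕ) : ℝ) ^ (-γ)) ≤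
        1 / (16 * B ^ 2) := by
  have hlim : Filter.Tendsto (fun n : ℕ => (n : ℝ) ^ (-(γ - 1))) Filter.atTop (nhds 0) :=
    (tendsto_rpow_neg_atTop (by linarith)).comp tendsto_natCast_atTop_atTop
  obtain ⟨B, hB2, hB1⟩ := ((hlim.eventually_le_const (by norm_num : (0 : ℝ) < 1 / 2)).and
    (Filter.eventually_ge_atTop 1)).exists
  obtain ⟨D, hD⟩ := exists_nat_ge (12 / μ)
  have hB0 : (0 : ℝ) < B := by exact_mod_cast hB1
  have hlim2 := hlim.const_mul ((D : ℝ) * K)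
  rw [mul_zero] at hlim2
  obtain ⟨s₀, hs2, hs1⟩ := ((hlim2.eventually_le_const
    (by positivity : (0 : ℝ) < 1 / (16 * B ^ 2))).and (Filter.eventually_ge_atTop 1)).exists
  have hs0 : (0 : ℝ) < s₀ := by exact_mod_cast hs1
  have hD0 : (0 : ℝ) < D := lt_of_lt_of_le (by positivity) hD
  refine ⟨B, D, s₀, hB1, by rw [div_le_iff₀ hμ] at hD; linarith,
    by exact_mod_cast Nat.one_le_iff_ne_zero.2 (by exact_mod_cast hD0.ne'), hs1, fun n => ?_⟩
  have hpow : ∀ x : ℝ, 0 < x → x * x ^ (-γ) = x ^ (-(γ - 1)) := fun x hx => by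
    rw [show -(γ - 1) = 1 + -γ by ring, Real.rpow_add hx, Real.rpow_one]
  have heq : ((D * s₀ * (2 * B) ^ n : ℕ) : ℝ) * (K * ((s₀ * B ^ n : ℕ) : ℝ) ^ (-γ)) =
      (D * K * (s₀ : ℝ) ^ (-(γ - 1))) * (2 * (B : ℝ) ^ (-(γ - 1))) ^ n := by
    push_cast
    rw [Real.mul_rpow hs0.le (by positivity), ← hpow _ hs0, ← hpow _ hB0,
      ← Real.rpow_pow_comm hB0.le]
    simp only [mul_pow]
    ring
  rw [heq]
  refine (mul_le_of_le_one_right (by positivity) (pow_le_one₀ (by positivity) ?_)).trans hs2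
  linarith

/-- At every length scale, all blocks are simultaneously good with high probability. -/
lemma exists_good_scale {β μ : ℝ} (hβ : 1 < β) (hμ : 0 < μ) :
    ∃ p₀ : ℝ, 0 < p₀ ∧ ∀ c : ℤ × ℤ → NNReal,
      (∀ u v : ℤ, u + 2 ≤ v → β / ((v - u : ℤ) : ℝ) ^ 2 ≤ c (u, v)) →
      (∀ a : ℤ, Real.exp (-c (a, a + 1)) ≤ p₀) → ∀ L : ℕ, 1 ≤ L →
      ∃ h k m : ℕ, ∃ p : ℝ, h ≤ L ∧ L ≤ m * h ∧ 2 * k < h ∧ (k : ℝ) ≤ μ * h ∧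
        (∀ a : ℤ, (percolation c).real {ω | ¬ HasCluster ω a (a + 2 * h) k} ≤ p) ∧
        (m + 3) * p ≤ μ := by
  set γ : ℝ := (1 + β) / 2 with hγ
  obtain ⟨ν, hν0, hνμ, hν4, hνβ⟩ : ∃ ν : ℝ, 0 < ν ∧ ν ≤ μ ∧ ν ≤ 1 / 4 ∧ ν * (2 * β) ≤ β - 1 := by
    refine ⟨min μ (min (1 / 4) ((β - 1) / (2 * β))), ?_, min_le_left _ _,
      (min_le_right _ _).trans (min_le_left _ _), ?_⟩
    · refine lt_min hμ (lt_min (by norm_num) (div_pos (by linarith) (by linarith)))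
    · rw [← le_div_iff₀ (by linarith)]
      exact (min_le_right _ _).trans (min_le_right _ _)
  have hγ1 : 1 < γ := by rw [hγ]; linarith
  obtain ⟨B, D, s₀, hB, hD, hD1, hs₀, hq⟩ :=
    exists_growth hγ1 hν0 (Real.exp (γ * (Real.log 3 + 1))) (Real.exp_pos _).le
  set C : ℕ → ℕ := fun n => D * s₀ * (2 * B) ^ n with hCdef
  set s : ℕ → ℕ := fun n => s₀ * B ^ n with hsdef
  have hD12 : (12 : ℝ) ≤ D := by nlinarith
  have hC12 : ∀ n, 12 ≤ C n := fun n => by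
    have h1 : 12 ≤ D := by exact_mod_cast hD12
    have h2 : 1 ≤ (2 * B) ^ n := Nat.one_le_pow _ _ (by omega)
    simp only [hCdef]
    nlinarith [Nat.mul_le_mul h1 hs₀]
  have hs1 : ∀ n, 1 ≤ s n := fun n => Nat.one_le_iff_ne_zero.2 (by
    simp only [hsdef]; positivity)
  have hBR : (1 : ℝ) ≤ B := by exact_mod_cast hB
  have hCR : ∀ n, (12 : ℝ) ≤ C n := fun n => by exact_mod_cast hC12 n
  set δ : ℝ := 1 / (32 * B ^ 2) with hδ
  have hδ0 : 0 < δ := by positivity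
  refine ⟨δ / (C 0 : ℝ) ^ 2, by have := hCR 0; positivity, fun c hc hnn L hL => ?_⟩
  have hpos : ∀ n, 0 < blockLength C n := by
    intro n
    induction n with
    | zero => simp [blockLength]
    | succ n ih => exact Nat.mul_pos (by linarith [hC12 n]) ih
  have hdef : ∀ n, (blockDefect C s n : ℝ) ≤ ν * (1 - (1 / 2) ^ n) * blockLength C n := by
    intro n
    induction n with
    | zero => simp [blockDefect]
    | succ n ih =>
      have h1 : (0 : ℝ) < blockLength C n := by exact_mod_cast hpos n
      have h2 := mul_le_mul_of_nonneg_left ih (Nat.cast_nonneg (C n) : (0 : ℝ) ≤ C n)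
      have h3 : (2 * s n + 4 : ℝ) ≤ ν * (1 / 2) ^ (n + 1) * C n := by
        have h4 : (1 : ℝ) ≤ s n := by exact_mod_cast hs1 n
        have h5 : ν * (1 / 2) ^ (n + 1) * C n = ν * D * s n / 2 := by
          simp only [hCdef, hsdef]
          push_cast
          rw [pow_succ, mul_pow]
          have : (1 / 2 : ℝ) ^ n * 2 ^ n = 1 := by rw [← mul_pow]; norm_num
          linear_combination (ν * D * s₀ * B ^ n / 2) * this
        rw [h5]
        nlinarith
      have h6 := mul_le_mul_of_nonneg_right h3 h1.le
      simp only [blockDefect, blockLength]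
      push_cast
      rw [pow_succ] at h6 ⊢
      nlinarith
  have hdef' : ∀ n, (blockDefect C s n : ℝ) ≤ ν * blockLength C n := fun n => by
    have h1 : (0 : ℝ) < blockLength C n := by exact_mod_cast hpos n
    refine (hdef n).trans ?_
    have : (0 : ℝ) ≤ (1 / 2) ^ n := by positivity
    exact mul_le_mul_of_nonneg_right (mul_le_of_le_one_right hν0.le (by linarith)) h1.le
  have hk : ∀ n, 2 * blockDefect C s n < blockLength C n := fun n => by
    have h1 : (0 : ℝ) < blockLength C n := by exact_mod_cast hpos n
    have h2 := hdef' n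
    have : (2 * blockDefect C s n : ℝ) < blockLength C n := by nlinarith
    exact_mod_cast this
  have hprob : ∀ n (a : ℤ), (percolation c).real
      {ω | ¬ HasCluster ω a (a + 2 * (blockLength C n : ℕ)) (blockDefect C s n)} ≤
        δ / (C n : ℝ) ^ 2 := by
    intro n
    induction n with
    | zero =>
      intro a
      have := (percolation_not_hasCluster_two_le c a).trans (hnn a)
      simpa [blockLength, blockDefect] using this
    | succ n ih =>
      intro a
      have h1 : (0 : ℝ) < blockLength C n := by exact_mod_cast hpos n
      have hCn : (0 : ℝ) < C n := by linarith [hCR n]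
      have hkγ : γ ≤ β * (1 - blockDefect C s n / (2 * blockLength C n)) ^ 2 := by
        have h2 : (blockDefect C s n / (2 * blockLength C n) : ℝ) ≤ ν / 2 := by
          rw [div_le_iff₀ (by positivity)]
          linarith [hdef' n]
        have h3 : (1 - ν / 2) ^ 2 ≤ (1 - blockDefect C s n / (2 * blockLength C n) : ℝ) ^ 2 :=
          pow_le_pow_left₀ (by linarith) (by linarith) 2
        have h4 := mul_le_mul_of_nonneg_left h3 (by linarith : (0 : ℝ) ≤ β)
        refine le_trans ?_ h4
        rw [hγ]
        nlinarith [mul_nonneg (by linarith : (0 : ℝ) ≤ β) (sq_nonneg ν)]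
      refine (percolation_not_hasCluster_step (by linarith) (by linarith) hc (hk n)
        (by linarith [hC12 n] : 1 ≤ C n) (hs1 n) hkγ ih a).trans ?_
      have hCs : (C (n + 1) : ℝ) = C n * (2 * B) := by
        simp only [hCdef]
        push_cast
        ring
      have hqn := hq n
      set q : ℝ := Real.exp (γ * (Real.log 3 + 1)) * (s n : ℝ) ^ (-γ) with hqdef
      change (C n : ℝ) * q ≤ 1 / (16 * B ^ 2) at hqn
      rw [hCs]
      have e1 : 4 * (C n : ℝ) ^ 2 * (δ / (C n : ℝ) ^ 2) ^ 2 +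
          2 * C n * (δ / (C n : ℝ) ^ 2 * q) = δ / (C n : ℝ) ^ 2 * (4 * δ + 2 * (C n * q)) := by
        field_simp
      have e2 : δ / ((C n : ℝ) * (2 * B)) ^ 2 = δ / (C n : ℝ) ^ 2 * (1 / (4 * B ^ 2)) := by
        field_simp
        norm_num
      rw [e1, e2]
      refine mul_le_mul_of_nonneg_left ?_ (by positivity)
      have e3 : 4 * δ + 2 * (1 / (16 * (B : ℝ) ^ 2)) = 1 / (4 * B ^ 2) := by
        rw [hδ]
        field_simp
        norm_num
      linarith
  obtain ⟨n, hn1, hn2⟩ := exists_blockLength_le (fun n => by linarith [hC12 n] : ∀ n, 2 ≤ C n) hL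
  refine ⟨blockLength C n, blockDefect C s n, C n, δ / (C n : ℝ) ^ 2, hn1, hn2.le, hk n,
    (hdef' n).trans (mul_le_mul_of_nonneg_right hνμ (Nat.cast_nonneg _)), hprob n, ?_⟩
  refine le_trans ?_ hνμ
  have hCn := hCR n
  have hδ1 : δ ≤ 1 / 32 := by
    rw [hδ]
    exact one_div_le_one_div_of_le (by norm_num) (by nlinarith)
  have hCD : (D : ℝ) ≤ C n := by
    have h2 : 1 ≤ (2 * B) ^ n := Nat.one_le_pow _ _ (by omega)
    have : D ≤ C n := by
      simp only [hCdef]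
      rw [mul_assoc]
      exact Nat.le_mul_of_pos_right D (Nat.mul_pos hs₀ h2)
    exact_mod_cast this
  rw [mul_div_assoc', div_le_iff₀ (by positivity)]
  have h7 : 12 ≤ ν * C n := hD.trans (mul_le_mul_of_nonneg_left hCD hν0.le)
  nlinarith

end Scales

section TwoPoint

lemma mul_measureReal_le_sum {Ω ι : Type*} [MeasurableSpace Ω] (P : Measure Ω) [IsFiniteMeasure P]
    {T : Finset ι} {S : ι → Set Ω} (hS : ∀ e ∈ T, MeasurableSet (S e)) {G : Set Ω}
    (hG : MeasurableSet G) {K : ℝ} (h : ∀ ω ∈ G, K ≤ ∑ e ∈ T, (S e).indicator (fun _ => 1) ω) :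
    K * P.real G ≤ ∑ e ∈ T, P.real (S e) := by
  have hint : ∀ e ∈ T, Integrable ((S e).indicator fun _ => (1 : ℝ)) P := fun e he =>
    (integrable_const 1).indicator (hS e he)
  have h1 : ∑ e ∈ T, P.real (S e) = ∫ ω, ∑ e ∈ T, (S e).indicator (fun _ => (1 : ℝ)) ω ∂P := by
    rw [integral_finsetSum _ hint]
    refine Finset.sum_congr rfl fun e he => ?_
    rw [integral_indicator_const _ (hS e he), smul_eq_mul, mul_one]
  have h2 : K * P.real G = ∫ ω, G.indicator (fun _ => K) ω ∂P := by
    rw [integral_indicator_const _ hG, smul_eq_mul, mul_comm]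
  rw [h1, h2]
  refine integral_mono ((integrable_const K).indicator hG) (integrable_finsetSum _ hint) fun ω => ?_
  by_cases hω : ω ∈ G
  · simpa [hω] using h ω hω
  · simp only [hω, not_false_eq_true, Set.indicator_of_notMem]
    exact Finset.sum_nonneg fun e _ => Set.indicator_nonneg (fun _ _ => zero_le_one) _

/-- Two sites at distance at least `L` are connected with high probability. -/
lemma exists_conn_pair {β ε : ℝ} (hβ : 1 < β) (hε : 0 < ε) :
    ∃ p₀ : ℝ, 0 < p₀ ∧ ∀ c : ℤ × ℤ → NNReal,
      (∀ u v : ℤ, u + 2 ≤ v → β / ((v - u : ℤ) : ℝ) ^ 2 ≤ c (u, v)) →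
      (∀ a : ℤ, Real.exp (-c (a, a + 1)) ≤ p₀) → ∀ L : ℕ, 1 ≤ L →
      ∃ N x y : ℤ, 0 ≤ x ∧ x ≤ L ∧ x + L ≤ y ∧
        1 - ε ≤ (percolation c).real {ω | Conn ω 0 N x y} := by
  obtain ⟨μ, hμ0, hμε, hμ1⟩ : ∃ μ : ℝ, 0 < μ ∧ μ ≤ ε / 3 ∧ μ ≤ 1 / 2 :=
    ⟨min (ε / 3) (1 / 2), lt_min (by linarith) (by norm_num), min_le_left _ _, min_le_right _ _⟩
  obtain ⟨p₀, hp₀, H⟩ := exists_good_scale hβ hμ0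
  refine ⟨p₀, hp₀, fun c hc hnn L hL => ?_⟩
  obtain ⟨h, k, m, p, hhL, hLm, hk, hkμ, hp, hmp⟩ := H c hc hnn L hL
  have hh : (0 : ℝ) < h := by exact_mod_cast (by omega : 0 < h)
  have hp0 : 0 ≤ p := measureReal_nonneg.trans (hp 0)
  set P := percolation c with hP
  set bad : ℕ → Set (ℤ × ℤ → Bool) := fun i =>
    {ω | ¬ HasCluster ω ((i : ℤ) * h) ((i : ℤ) * h + 2 * h) k} with hbad
  set A : Finset ℤ := Finset.Ico 0 (h : ℤ) with hA
  set B : Finset ℤ := Finset.Ico (((m : ℤ) + 1) * h) (((m : ℤ) + 3) * h) with hB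
  set G : Set (ℤ × ℤ → Bool) := (⋃ i ∈ Finset.range (m + 2), bad i)ᶜ with hG
  have hbadm : MeasurableSet (⋃ i ∈ Finset.range (m + 2), bad i) :=
    Finset.measurableSet_biUnion _ fun i _ => (determinedBy_not_hasCluster _ _ _).measurableSet
  have hGP : 1 - μ ≤ P.real G := by
    rw [hG, probReal_compl_eq_one_sub hbadm]
    have h1 := measureReal_biUnion_finset_le (μ := P) (Finset.range (m + 2)) bad
    have h2 : ∑ i ∈ Finset.range (m + 2), P.real (bad i) ≤ (m + 2) * p := by
      refine (Finset.sum_le_card_nsmul _ _ p fun i _ => hp _).trans ?_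
      rw [Finset.card_range, nsmul_eq_mul]
      push_cast
      exact le_rfl
    nlinarith
  have hAc : A.card = h := by simp [hA]
  have hBc : B.card = 2 * h := by
    rw [hB, Int.card_Ico, show ((m : ℤ) + 3) * h - (m + 1) * h = (2 * h : ℕ) by push_cast; ring,
      Int.toNat_natCast]
  by_contra! hcon
  have hlow := mul_measureReal_le_sum P (T := A ×ˢ B)
    (S := fun e => {ω | Conn ω 0 (((m : ℤ) + 3) * h) e.1 e.2})
    (fun e _ => (determinedBy_conn _ _ _ _).measurableSet) (G := G) hbadm.compl
    (K := ((h : ℝ) - k) * (2 * h - k)) ?_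
  · have hup : ∑ e ∈ A ×ˢ B, P.real {ω | Conn ω 0 (((m : ℤ) + 3) * h) e.1 e.2} <
        ∑ e ∈ A ×ˢ B, (1 - ε) := by
      refine Finset.sum_lt_sum_of_nonempty ?_ fun e he => ?_
      · rw [← Finset.card_pos, Finset.card_product, hAc, hBc]
        exact Nat.mul_pos (by omega) (by omega)
      · simp only [hA, hB, Finset.mem_product, Finset.mem_Ico] at he
        have h3 : (L : ℤ) ≤ m * h := by exact_mod_cast hLm
        refine hcon _ _ _ he.1.1 (by omega) ?_
        nlinarith [he.1.2, he.2.1]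
    rw [Finset.sum_const, Finset.card_product, hAc, hBc, nsmul_eq_mul] at hup
    push_cast at hup
    have h4 : (1 - μ) * h * ((2 - μ) * h) ≤ ((h : ℝ) - k) * (2 * h - k) :=
      mul_le_mul (by linarith) (by linarith) (mul_nonneg (by linarith) hh.le) (by nlinarith)
    have h5 : (1 - μ) * h * ((2 - μ) * h) * (1 - μ) ≤ ((h : ℝ) - k) * (2 * h - k) * P.real G :=
      mul_le_mul h4 hGP (by linarith) (le_trans (mul_nonneg (mul_nonneg (by linarith) hh.le)
        (mul_nonneg (by linarith) hh.le)) h4)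
    have h6 : (1 - μ) * (2 - μ) * (1 - μ) * (h : ℝ) ^ 2 < (1 - ε) * 2 * (h : ℝ) ^ 2 := by
      nlinarith
    have h7 := lt_of_mul_lt_mul_right h6 (by positivity)
    nlinarith [sq_nonneg μ]
  · intro ω hω
    have hgood : ∀ i : ℕ, i < m + 2 → HasCluster ω (0 + i * h) (0 + (i + 2) * h) k := by
      intro i hi
      by_contra hne
      refine hω (Set.mem_biUnion (Finset.mem_coe.2 (Finset.mem_range.2 hi)) ?_)
      simp only [hbad, Set.mem_ofPred_eq]
      convert hne using 2 <;> ring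
    obtain ⟨U, hU⟩ := exists_isChain hk (m + 2) hgood
    have hUA : h - k ≤ (A ∩ U).card := by
      have h1 := hU.missing 0 (by omega)
      have h2 : (A \ U).card ≤ k := by
        refine (Finset.card_le_card (Finset.sdiff_subset_sdiff ?_ subset_rfl)).trans h1
        intro z hz
        simp only [hA, Finset.mem_Ico] at hz ⊢
        push_cast
        omega
      have h3 := Finset.card_sdiff_add_card_inter A U
      omega
    have hUB : 2 * h - k ≤ (B ∩ U).card := by
      have h1 := hU.missing (m + 1) (by omega)
      have h2 : (B \ U).card ≤ k := by
        convert h1 using 4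
        · push_cast; ring
        · push_cast; ring
      have h3 := Finset.card_sdiff_add_card_inter B U
      omega
    have hsub : (A ∩ U) ×ˢ (B ∩ U) ⊆ A ×ˢ B :=
      Finset.product_subset_product Finset.inter_subset_left Finset.inter_subset_left
    refine le_trans ?_ (Finset.sum_le_sum_of_subset_of_nonneg hsub fun e _ _ =>
      Set.indicator_nonneg (fun _ _ => zero_le_one) _)
    have hone : ∀ e ∈ (A ∩ U) ×ˢ (B ∩ U),
        ({ω | Conn ω 0 (((m : ℤ) + 3) * h) e.1 e.2} : Set (ℤ × ℤ → Bool)).indicator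
          (fun _ => (1 : ℝ)) ω = 1 := by
      intro e he
      simp only [Finset.mem_product, Finset.mem_inter] at he
      refine Set.indicator_of_mem ?_ _
      have := hU.conn e.1 he.1.2 e.2 he.2.2
      rw [Set.mem_ofPred_eq]
      convert this using 1
      push_cast
      ring
    rw [Finset.sum_congr rfl hone, Finset.sum_const, nsmul_one, Finset.card_product, Nat.cast_mul]
    have c1 : (h : ℝ) ≤ (A ∩ U).card + k := by exact_mod_cast (by omega : h ≤ (A ∩ U).card + k)
    have c2 : (2 * h : ℝ) ≤ (B ∩ U).card + k := by
      exact_mod_cast (by omega : 2 * h ≤ (B ∩ U).card + k)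
    have c3 : (2 * k : ℝ) < h := by exact_mod_cast hk
    exact mul_le_mul (by linarith) (by linarith) (by linarith) (Nat.cast_nonneg _)

end TwoPoint

section Coupling

lemma one_sub_exp_neg_le_tanh {K : ℝ} (hK : 0 ≤ K) : 1 - Real.exp (-K) ≤ Real.tanh K := by
  have h0 : 0 < Real.exp (-K) := Real.exp_pos _
  have h1 : Real.exp (-K) ≤ 1 := by simpa using hK
  have h2 : Real.exp K * Real.exp (-K) = 1 := by rw [← Real.exp_add]; simp
  have h3 : 0 < Real.exp K := Real.exp_pos _
  rw [Real.tanh_eq_sinh_div_cosh, le_div_iff₀ (Real.cosh_pos _), Real.sinh_eq, Real.cosh_eq]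
  nlinarith [mul_nonneg (sub_nonneg.2 h1) h0.le]

variable {G ι : Type*} [CommGroup G]

lemma exp_mul_signChar (ψ : G →* ℤˣ) (K : ℝ) (g : G) :
    Real.exp (K * signChar ψ g) = Real.cosh K * (1 + Real.tanh K * signChar ψ g) := by
  have h : Real.cosh K * Real.tanh K = Real.sinh K := by
    rw [Real.tanh_eq_sinh_div_cosh]
    field_simp [(Real.cosh_pos K).ne']
  rw [mul_add, mul_one, ← mul_assoc, h]
  rcases signChar_eq_or ψ g with h | h <;> rw [h]
  · rw [mul_one, mul_one, Real.cosh_add_sinh]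
  · rw [mul_neg_one, mul_neg_one, ← sub_eq_add_neg, Real.cosh_sub_sinh]

lemma exp_sum_mul_signChar (I : Finset ι) (χ : ι → G →* ℤˣ) (K : ι → ℝ) (g : G) :
    Real.exp (∑ i ∈ I, K i * signChar (χ i) g) =
      (∏ i ∈ I, Real.cosh (K i)) * ferroWeight I χ (fun i => Real.tanh (K i)) g := by
  rw [Real.exp_sum, ferroWeight, ← Finset.prod_mul_distrib]
  exact Finset.prod_congr rfl fun i _ => exp_mul_signChar _ _ _

/-- The probability that the open edges force the spin `ψ` to be `1` bounds its mean below. -/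
lemma percolation_mul_sum_exp_le [Fintype G] (I s : Finset ι) (hs : s ⊆ I) (χ : ι → G →* ℤˣ)
    (ψ : G →* ℤˣ) (K : ι → ℝ) (hK : ∀ i ∈ I, 0 ≤ K i) (c : ι → NNReal)
    (hc : ∀ i ∈ s, (c i : ℝ) = K i) (A : Set (ι → Bool))
    (hA : ∀ ω ∈ A, ∀ g, (∀ i ∈ s, ω i = true → χ i g = 1) → ψ g = 1) :
    (percolation c).real A * ∑ g, Real.exp (∑ i ∈ I, K i * signChar (χ i) g) ≤
      ∑ g, signChar ψ g * Real.exp (∑ i ∈ I, K i * signChar (χ i) g) := by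
  classical
  have ht : ∀ i ∈ I, 0 ≤ Real.tanh (K i) ∧ Real.tanh (K i) ≤ 1 := fun i hi =>
    ⟨le_trans (by simpa using hK i hi) (one_sub_exp_neg_le_tanh (hK i hi)),
      (Real.tanh_lt_one _).le⟩
  have hmean := sum_forced_le_ferroMean I χ ψ (fun i => 1 - Real.exp (-K i))
    (fun i hi => by have := hK i hi; simpa using this) s hs (fun i => Real.tanh (K i)) ht
    (fun i hi => one_sub_exp_neg_le_tanh (hK i (hs hi)))
  have hprob : (percolation c).real A ≤ ferroMean I χ (fun i => Real.tanh (K i)) ψ := by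
    refine le_trans ?_ hmean
    set T := s.powerset.filter fun η => ∀ g, (∀ i ∈ η, χ i g = 1) → ψ g = 1 with hT
    have hsub : A ⊆ ⋃ η ∈ T, {ω | ∀ i ∈ s, ω i = decide (i ∈ η)} := by
      intro ω hω
      refine Set.mem_biUnion (x := s.filter fun i => ω i = true) ?_ ?_
      · rw [Finset.mem_coe, hT, Finset.mem_filter]
        refine ⟨Finset.mem_powerset.2 (Finset.filter_subset _ _), fun g hg => ?_⟩
        exact hA ω hω g fun i hi hi' => hg i (Finset.mem_filter.2 ⟨hi, hi'⟩)
      · intro i hi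
        simp [hi]
    refine (measureReal_mono hsub (measure_ne_top _ _)).trans
      ((measureReal_biUnion_finset_le _ _).trans ?_)
    convert le_of_eq (Finset.sum_congr rfl fun η _ => ?_) using 1
    rw [percolation_cylinder c s fun i => decide (i ∈ η)]
    refine Finset.prod_congr rfl fun i hi => ?_
    simp only [decide_eq_true_eq, hc i hi, sub_sub_cancel]
  simp_rw [exp_sum_mul_signChar]
  have hpos := sum_ferroWeight_pos I χ (fun i => Real.tanh (K i)) ht
  rw [ferroMean, le_div_iff₀ hpos] at hprob
  have hcosh : 0 ≤ ∏ i ∈ I, Real.cosh (K i) :=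
    Finset.prod_nonneg fun i _ => (Real.cosh_pos _).le
  simp_rw [mul_left_comm _ (∏ i ∈ I, Real.cosh (K i)), ← Finset.mul_sum]
  rw [mul_left_comm]
  exact mul_le_mul_of_nonneg_left hprob hcosh

end Coupling

section Ising

/-- The sign `±1` coded by a Boolean. -/
def boolEquivSign : Bool ≃ ℤˣ where
  toFun b := if b then 1 else -1
  invFun u := decide (u = 1)
  left_inv := by decide
  right_inv := by decide

lemma coe_boolEquivSign (b : Bool) : (((boolEquivSign b : ℤˣ) : ℤ) : ℝ) = spinVal b := by
  cases b <;> simp [boolEquivSign, spinVal]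

/-- The spin at `z`, equal to `1` outside `[-L, L-1]`. -/
noncomputable def siteSpin (L : ℕ) (z : ℤ) :
    ({x : ℤ // x ∈ Finset.Icc (-(L : ℤ)) ((L : ℤ) - 1)} → ℤˣ) →* ℤˣ :=
  if h : z ∈ Finset.Icc (-(L : ℤ)) ((L : ℤ) - 1) then Pi.evalMonoidHom (fun _ => ℤˣ) ⟨z, h⟩ else 1

lemma siteSpin_apply {L : ℕ} {z : ℤ} (h : z ∈ Finset.Icc (-(L : ℤ)) ((L : ℤ) - 1))
    (g : {x : ℤ // x ∈ Finset.Icc (-(L : ℤ)) ((L : ℤ) - 1)} → ℤˣ) :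
    siteSpin L z g = g ⟨z, h⟩ := by
  rw [siteSpin, dif_pos h, Pi.evalMonoidHom_apply]

lemma siteSpin_of_le {L : ℕ} {z : ℤ} (h : (L : ℤ) ≤ z) : siteSpin L z = 1 := by
  rw [siteSpin, dif_neg]
  simp only [Finset.mem_Icc]
  omega

lemma signChar_siteSpin {L : ℕ} (s : {x : ℤ // x ∈ Finset.Icc (-(L : ℤ)) ((L : ℤ) - 1)} → Bool)
    (x : {x : ℤ // x ∈ Finset.Icc (-(L : ℤ)) ((L : ℤ) - 1)}) :
    signChar (siteSpin L x) (fun y => boolEquivSign (s y)) = spinVal (s x) := by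
  rw [signChar, siteSpin_apply x.2, coe_boolEquivSign]

/-- The part of the field not coming from `[L, M)`. -/
noncomputable def tailField (J : ℝ) (L : ℕ) (M z : ℤ) : ℝ :=
  isingField J L z - ∑ w ∈ Finset.Ico (L : ℤ) M, isingCoupling J z w

lemma sum_Ico_inv_sq_le_tsum {a z : ℤ} (h : z < a) (M : ℤ) :
    ∑ w ∈ Finset.Ico a M, 1 / ((z - w : ℤ) : ℝ) ^ 2 ≤
      ∑' n : ℕ, 1 / ((a + (n : ℤ) - z : ℤ) : ℝ) ^ 2 := by
  have hsum : Summable fun n : ℕ => 1 / ((a + (n : ℤ) - z : ℤ) : ℝ) ^ 2 := by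
    have h1 : Summable fun n : ℕ => 1 / ((n + 1 : ℕ) : ℝ) ^ 2 :=
      (summable_nat_add_iff 1).2 (Real.summable_one_div_nat_pow.2 one_lt_two)
    refine h1.of_nonneg_of_le (fun n => by positivity) fun n => ?_
    refine one_div_le_one_div_of_le (by positivity) (pow_le_pow_left₀ (by positivity) ?_ 2)
    exact_mod_cast (by push_cast; omega : ((n + 1 : ℕ) : ℤ) ≤ a + n - z)
  have hmap : ∑ w ∈ Finset.Ico a M, 1 / ((z - w : ℤ) : ℝ) ^ 2 =
      ∑ n ∈ Finset.range (M - a).toNat, 1 / ((a + (n : ℤ) - z : ℤ) : ℝ) ^ 2 := by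
    symm
    refine Finset.sum_bij (fun n _ => a + (n : ℤ)) ?_ ?_ ?_ ?_
    · intro n hn
      rw [Finset.mem_range] at hn
      rw [Finset.mem_Ico]
      omega
    · intro m _ n _ hmn
      omega
    · intro w hw
      rw [Finset.mem_Ico] at hw
      exact ⟨(w - a).toNat, by rw [Finset.mem_range]; omega, by omega⟩
    · intro n _
      push_cast
      ring
  rw [hmap]
  exact hsum.sum_le_tsum _ fun n _ => by positivity

lemma tailField_nonneg {J : ℝ} (hJ : 0 ≤ J) {L : ℕ} (M : ℤ) {z : ℤ} (hz : z < L) :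
    0 ≤ tailField J L M z := by
  have h1 := sum_Ico_inv_sq_le_tsum (z := z) (a := max (L : ℤ) (z + 2)) (by omega) M
  rw [tailField, isingField, sub_nonneg]
  refine le_trans ?_ (add_le_add_right h1 _)
  by_cases hzL : z = (L : ℤ) - 1
  · rw [if_pos hzL]
    rcases le_or_gt M L with hM | hM
    · rw [Finset.Ico_eq_empty (by omega), Finset.sum_empty]
      exact add_nonneg hJ (Finset.sum_nonneg fun _ _ => by positivity)
    · rw [← Finset.add_sum_Ioo_eq_sum_Ico hM]
      refine add_le_add (by rw [isingCoupling, if_pos (by omega)]) (le_of_eq ?_)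
      rw [show Finset.Ioo (L : ℤ) M = Finset.Ico (max (L : ℤ) (z + 2)) M by
        ext w; simp only [Finset.mem_Ioo, Finset.mem_Ico]; omega]
      refine Finset.sum_congr rfl fun w hw => ?_
      rw [Finset.mem_Ico] at hw
      rw [isingCoupling, if_neg (by omega)]
  · rw [if_neg hzL, zero_add, show max (L : ℤ) (z + 2) = L by omega]
    refine le_of_eq (Finset.sum_congr rfl fun w hw => ?_)
    rw [Finset.mem_Ico] at hw
    rw [isingCoupling, if_neg (by omega)]

/-- The bonds of the box `[-L, L-1]`, including those with the plus spins in `[L, M)`. -/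
noncomputable def bonds (L : ℕ) (M : ℤ) : Finset (ℤ × ℤ) :=
  (Finset.Icc (-(L : ℤ)) ((L : ℤ) - 1) ×ˢ Finset.Ico (-(L : ℤ)) M).filter fun e => e.1 < e.2

/-- The diagonal of the box, carrying the remaining field. -/
noncomputable def diagonal (L : ℕ) : Finset (ℤ × ℤ) :=
  (Finset.Icc (-(L : ℤ)) ((L : ℤ) - 1)).image fun z => (z, z)

/-- The product of the two spins of a bond, or the spin at a diagonal pair. -/
noncomputable def bondSpin (L : ℕ) (e : ℤ × ℤ) :
    ({x : ℤ // x ∈ Finset.Icc (-(L : ℤ)) ((L : ℤ) - 1)} → ℤˣ) →* ℤˣ :=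
  if e.1 = e.2 then siteSpin L e.1 else siteSpin L e.1 * siteSpin L e.2

/-- The interaction strength of a bond, or the remaining field at a diagonal pair. -/
noncomputable def bondStrength (β J : ℝ) (L : ℕ) (M : ℤ) (e : ℤ × ℤ) : ℝ :=
  β * if e.1 = e.2 then tailField J L M e.1 else isingCoupling J e.1 e.2

lemma disjoint_bonds_diagonal (L : ℕ) (M : ℤ) : Disjoint (bonds L M) (diagonal L) := by
  rw [Finset.disjoint_left]
  intro e he he'
  simp only [bonds, diagonal, Finset.mem_filter, Finset.mem_image] at he he'
  obtain ⟨z, _, rfl⟩ := he'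
  exact lt_irrefl _ he.2

lemma isingHamiltonian_eq_sum_bonds (β J : ℝ) {L : ℕ} {M : ℤ} (hM : (L : ℤ) ≤ M)
    (s : {x : ℤ // x ∈ Finset.Icc (-(L : ℤ)) ((L : ℤ) - 1)} → Bool) :
    isingHamiltonian β J L s = ∑ e ∈ bonds L M ∪ diagonal L,
      bondStrength β J L M e * signChar (bondSpin L e) fun y => boolEquivSign (s y) := by
  set σ : ℤ → ℝ := fun z => signChar (siteSpin L z) fun y => boolEquivSign (s y) with hσ
  obtain ⟨Λ, hΛ⟩ : ∃ Λ, Λ = Finset.Icc (-(L : ℤ)) ((L : ℤ) - 1) := ⟨_, rfl⟩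
  have hleft : isingHamiltonian β J L s = β * ((∑ x ∈ Λ, ∑ y ∈ Λ,
      if x < y then isingCoupling J x y * σ x * σ y else 0) +
        ∑ x ∈ Λ, isingField J L x * σ x) := by
    rw [isingHamiltonian, hΛ]
    simp_rw [← signChar_siteSpin s, ← Finset.sum_coe_sort (Finset.Icc (-(L : ℤ)) ((L : ℤ) - 1))]
    rfl
  have hbonds : ∑ e ∈ bonds L M, bondStrength β J L M e *
      signChar (bondSpin L e) (fun y => boolEquivSign (s y)) =
      ∑ x ∈ Λ, ∑ y ∈ Finset.Ico (-(L : ℤ)) M,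
        if x < y then β * (isingCoupling J x y * σ x * σ y) else 0 := by
    rw [bonds, Finset.sum_filter, Finset.sum_product, hΛ]
    refine Finset.sum_congr rfl fun x _ => Finset.sum_congr rfl fun y _ => ?_
    split_ifs with hxy
    · rw [bondStrength, bondSpin, if_neg (by simp only; omega), if_neg (by simp only; omega),
        signChar_mul]
      simp only [hσ]
      ring
    · rfl
  have hdiag : ∑ e ∈ diagonal L, bondStrength β J L M e *
      signChar (bondSpin L e) (fun y => boolEquivSign (s y)) =
      ∑ x ∈ Λ, β * (tailField J L M x * σ x) := by
    rw [diagonal, Finset.sum_image fun _ _ _ _ h => (Prod.ext_iff.1 h).1, hΛ]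
    refine Finset.sum_congr rfl fun x _ => ?_
    simp only [bondStrength, bondSpin, if_true, hσ]
    ring
  rw [Finset.sum_union (disjoint_bonds_diagonal L M), hbonds, hdiag, hleft, mul_add,
    Finset.mul_sum, Finset.mul_sum, ← Finset.sum_add_distrib, ← Finset.sum_add_distrib]
  refine Finset.sum_congr rfl fun x hx => ?_
  rw [hΛ, Finset.mem_Icc] at hx
  have hsplit := Finset.sum_union (Finset.Ico_disjoint_Ico_consecutive (-(L : ℤ)) L M)
    (f := fun y => if x < y then β * (isingCoupling J x y * σ x * σ y) else 0)
  rw [Finset.Ico_union_Ico_eq_Ico (by omega) hM] at hsplit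
  have hin : Finset.Ico (-(L : ℤ)) L = Λ := by
    ext; simp only [hΛ, Finset.mem_Ico, Finset.mem_Icc]; omega
  have hout : ∑ y ∈ Finset.Ico (L : ℤ) M,
      (if x < y then β * (isingCoupling J x y * σ x * σ y) else 0) =
      β * ((∑ y ∈ Finset.Ico (L : ℤ) M, isingCoupling J x y) * σ x) := by
    rw [Finset.sum_mul, Finset.mul_sum]
    refine Finset.sum_congr rfl fun y hy => ?_
    rw [Finset.mem_Ico] at hy
    have : σ y = 1 := by simp [hσ, siteSpin_of_le hy.1, signChar]
    rw [if_pos (by omega), this, mul_one]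
  rw [hsplit, hin, hout, Finset.mul_sum]
  simp_rw [mul_ite, mul_zero]
  rw [tailField]
  ring

lemma siteSpin_eq_of_conn {L : ℕ} {M N x u v : ℤ} {ω : ℤ × ℤ → Bool} (hx : x ≤ L)
    (hN : N ≤ M + x) {g : {x : ℤ // x ∈ Finset.Icc (-(L : ℤ)) ((L : ℤ) - 1)} → ℤˣ}
    (hg : ∀ e ∈ bonds L M, ω (e.1 + x, e.2 + x) = true → bondSpin L e g = 1)
    (h : Conn ω 0 N u v) : siteSpin L (u - x) g = siteSpin L (v - x) g := by
  induction h with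
  | rel u v h =>
    obtain ⟨h1, h2, h3, h4⟩ := h
    rcases le_or_gt (L : ℤ) (u - x) with hu | hu
    · rw [siteSpin_of_le hu, siteSpin_of_le (by omega)]
    · have := hg (u - x, v - x) (by
        simp only [bonds, Finset.mem_filter, Finset.mem_product, Finset.mem_Icc, Finset.mem_Ico]
        omega) (by simpa using h4)
      rw [bondSpin, if_neg (by simp only; omega), MonoidHom.mul_apply, mul_eq_one_iff_eq_inv,
        Int.units_inv_eq_self] at this
      exact this
  | refl => rfl
  | symm _ _ _ ih => exact ih.symm
  | trans _ _ _ _ _ ih1 ih2 => exact ih1.trans ih2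

lemma percolation_conn_mul_sum_le {β J : ℝ} (hβ : 0 ≤ β) (hJ : 0 ≤ J) {L : ℕ} {N x y : ℤ}
    (hx : x ≤ L) (hy : x + L ≤ y) (h0 : (0 : ℤ) ∈ Finset.Icc (-(L : ℤ)) ((L : ℤ) - 1)) :
    (percolation fun e => (β * isingCoupling J e.1 e.2).toNNReal).real {ω | Conn ω 0 N x y} *
        ∑ s : {x : ℤ // x ∈ Finset.Icc (-(L : ℤ)) ((L : ℤ) - 1)} → Bool,
          Real.exp (isingHamiltonian β J L s) ≤
      ∑ s : {x : ℤ // x ∈ Finset.Icc (-(L : ℤ)) ((L : ℤ) - 1)} → Bool,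
        spinVal (s ⟨0, h0⟩) * Real.exp (isingHamiltonian β J L s) := by
  set M : ℤ := max L (N - x) with hM
  set τ : ℤ × ℤ ≃ ℤ × ℤ := Equiv.addRight (x, x) with hτ
  have hcoup : ∀ u v, 0 ≤ isingCoupling J u v := fun u v => by
    rw [isingCoupling]; split_ifs <;> positivity
  have key := percolation_mul_sum_exp_le ((bonds L M ∪ diagonal L).map τ.toEmbedding)
    ((bonds L M).map τ.toEmbedding) (Finset.map_subset_map.2 Finset.subset_union_left)
    (fun e => bondSpin L (τ.symm e)) (siteSpin L 0) (fun e => bondStrength β J L M (τ.symm e))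
    ?_ (fun e => (β * isingCoupling J e.1 e.2).toNNReal) ?_ {ω | Conn ω 0 N x y} ?_
  · simp only [Finset.sum_map, Equiv.coe_toEmbedding, Equiv.symm_apply_apply] at key
    have htrans : ∀ F : ({x : ℤ // x ∈ Finset.Icc (-(L : ℤ)) ((L : ℤ) - 1)} → ℤˣ) → ℝ,
        ∑ s : {x : ℤ // x ∈ Finset.Icc (-(L : ℤ)) ((L : ℤ) - 1)} → Bool,
          F (fun y => boolEquivSign (s y)) = ∑ g, F g := fun F =>
      Equiv.sum_comp (Equiv.piCongrRight fun _ => boolEquivSign) F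
    have hden := htrans fun g =>
      Real.exp (∑ e ∈ bonds L M ∪ diagonal L, bondStrength β J L M e * signChar (bondSpin L e) g)
    have hnum := htrans fun g => signChar (siteSpin L 0) g *
      Real.exp (∑ e ∈ bonds L M ∪ diagonal L, bondStrength β J L M e * signChar (bondSpin L e) g)
    rw [← hden, ← hnum] at key
    simp_rw [isingHamiltonian_eq_sum_bonds β J (le_max_left (L : ℤ) (N - x)),
      ← fun s => signChar_siteSpin s ⟨0, h0⟩]
    exact key
  · intro e he
    obtain ⟨e, he', rfl⟩ := Finset.mem_map.1 he
    rw [Equiv.coe_toEmbedding, Equiv.symm_apply_apply, bondStrength]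
    refine mul_nonneg hβ ?_
    split_ifs with h
    · refine tailField_nonneg hJ M ?_
      simp only [bonds, diagonal, Finset.mem_union, Finset.mem_filter, Finset.mem_product,
        Finset.mem_image, Finset.mem_Icc] at he'
      rcases he' with hb | ⟨z, hz, rfl⟩
      · omega
      · simp only
        omega
    · exact hcoup _ _
  · intro e he
    obtain ⟨e, he', rfl⟩ := Finset.mem_map.1 he
    rw [Equiv.coe_toEmbedding, Equiv.symm_apply_apply, Real.coe_toNNReal _ (mul_nonneg hβ
      (hcoup _ _)), bondStrength]
    simp only [bonds, Finset.mem_filter] at he'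
    rw [if_neg (by omega)]
    simp [hτ, isingCoupling]
  · intro ω hω g hg
    have h1 := siteSpin_eq_of_conn (M := M) (g := g) hx (by rw [hM]; omega) (fun e he hωe => by
      have := hg (τ e) (Finset.mem_map_of_mem _ he) hωe
      rwa [Equiv.symm_apply_apply] at this) hω
    rw [sub_self, siteSpin_of_le (show (L : ℤ) ≤ y - x by omega)] at h1
    simpa using h1

end Ising

end LongRangeIsing

/-- For `β > 1`, the magnetization at the origin of the one-dimensional `1/r²` Ising model in
`[-L, L-1]` with one-sided plus boundary conditions on `[L, ∞)` is at least `1 - ε`,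
uniformly in `L`, once the nearest-neighbour coupling `J` is large enough. (Stated in
unnormalized form: `Σ_s σ₀(s) e^{βH(s)} ≥ (1-ε) Σ_s e^{βH(s)}`.) -/
theorem ising_one_sided_magnetization (β : ℝ) (hβ : 1 < β) (ε : ℝ) (hε : 0 < ε) :
    ∃ J₀ : ℝ, 0 < J₀ ∧ ∀ J : ℝ, J₀ ≤ J → ∀ L : ℕ, ∀ hL : 1 ≤ L,
      (1 - ε) * (∑ s : {x : ℤ // x ∈ Finset.Icc (-(L : ℤ)) ((L : ℤ) - 1)} → Bool,
          Real.exp (isingHamiltonian β J L s)) ≤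
        ∑ s : {x : ℤ // x ∈ Finset.Icc (-(L : ℤ)) ((L : ℤ) - 1)} → Bool,
          spinVal (s ⟨0, by simp only [Finset.mem_Icc]; omega⟩) *
            Real.exp (isingHamiltonian β J L s) := by
  obtain ⟨p₀, hp₀, H⟩ := LongRangeIsing.exists_conn_pair hβ hε
  refine ⟨max 1 (-Real.log p₀), lt_max_of_lt_left one_pos, fun J hJ L hL => ?_⟩
  obtain ⟨hJ1, hJ2⟩ := max_le_iff.1 hJ
  have hβ0 : 0 < β := by linarith
  obtain ⟨N, x, y, _, hx, hy, hP⟩ := H (fun e => (β * isingCoupling J e.1 e.2).toNNReal)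
    (fun u v huv => by
      refine le_trans (le_of_eq ?_) (Real.le_coe_toNNReal _)
      rw [isingCoupling, if_neg (by simp only; omega), mul_one_div]
      push_cast
      ring)
    (fun a => by
      rw [← Real.exp_log hp₀, isingCoupling, if_pos (by simp only; omega),
        Real.coe_toNNReal _ (by nlinarith)]
      exact Real.exp_le_exp.2 (by nlinarith)) L hL
  exact (mul_le_mul_of_nonneg_right hP (Finset.sum_nonneg fun _ _ => (Real.exp_pos _).le)).trans
    (LongRangeIsing.percolation_conn_mul_sum_le hβ0.le (by linarith) hx hy _)
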